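/- arXiv:1710.04109 — 10 statements merged into one kernel-verified Lean document; each statement's English description precedes it below -/
import Mathlib

section
/- Let n ≥ 2 be an integer and v > 0 a real number. The orbit of the set {α_0, α_1, …, α_n} of standard basis vectors of ℝ^{n+1} under the subgroup of GL(ℝ^{n+1}) generated by the reflections σ_0, σ_1, …, σ_n equals Φ(n,v) = { η v^m (c_{k+1} α_{i,j} + c_k α'_{i,j}) : η ∈ {1,−1}, m ∈ ℤ, k ∈ ℤ, 1 ≤ i ≤ j ≤ n }. -/
/-- The quantum integer `c_k`: `(v^k - v^(-k))/(v - v⁻¹)` if `v ≠ 1`, and `k` if `v = 1`. -/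
noncomputable def qint (v : ℝ) (k : ℤ) : ℝ :=
  if v = 1 then (k : ℝ) else (v ^ k - v ^ (-k)) / (v - v⁻¹)

/-- The root `α_{i,j} = α_i + α_{i+1} + ⋯ + α_j` in coordinates. -/
noncomputable def alphaIJ (n i j : ℕ) : Fin (n + 1) → ℝ :=
  fun l => if i ≤ (l : ℕ) ∧ (l : ℕ) ≤ j then 1 else 0

/-- The root `α'_{i,j} = α_0 + v(α_1 + ⋯ + α_{i-1}) + v⁻¹(α_{j+1} + ⋯ + α_n)` in coordinates. -/
noncomputable def alphaIJ' (n : ℕ) (v : ℝ) (i j : ℕ) : Fin (n + 1) → ℝ :=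
  fun l => if (l : ℕ) = 0 then 1
    else if (l : ℕ) < i then v
    else if j < (l : ℕ) then v⁻¹
    else 0

/-- `Φ_{i,j}(n,v) = { η v^m (c_{k+1} α_{i,j} + c_k α'_{i,j}) | η = ±1, m, k ∈ ℤ }`. -/
noncomputable def PhiIJ (n : ℕ) (v : ℝ) (i j : ℕ) : Set (Fin (n + 1) → ℝ) :=
  { x | ∃ (η : ℝ) (m k : ℤ), (η = 1 ∨ η = -1) ∧
      x = (η * v ^ m) • (qint v (k + 1) • alphaIJ n i j + qint v k • alphaIJ' n v i j) }

/-- The realized root system `Φ(n,v)` of affine type `Ã_n` with parameter `v`. -/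
noncomputable def Phi (n : ℕ) (v : ℝ) : Set (Fin (n + 1) → ℝ) :=
  ⋃ (i : ℕ) (j : ℕ) (_ : 1 ≤ i) (_ : i ≤ j) (_ : j ≤ n), PhiIJ n v i j

/-- The NGCM `C(n,v)` of affine type `Ã_n` with parameter `v`. -/
noncomputable def Cmat (n : ℕ) (v : ℝ) : Matrix (Fin (n + 1)) (Fin (n + 1)) ℝ :=
  Matrix.of fun i j =>
    if i = j then 2
    else if (i : ℕ) = 0 ∧ (j : ℕ) = 1 then -v
    else if (i : ℕ) = n ∧ (j : ℕ) = 0 then -v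
    else if (i : ℕ) = 1 ∧ (j : ℕ) = 0 then -v⁻¹
    else if (i : ℕ) = 0 ∧ (j : ℕ) = n then -v⁻¹
    else if (i : ℕ) + 1 = (j : ℕ) ∨ (j : ℕ) + 1 = (i : ℕ) then -1
    else 0

/-- The simple reflection `σ_j : x ↦ x - (∑_i C_{i,j} x_i) α_j` for the NGCM `C(n,v)`. -/
noncomputable def sigmaV (n : ℕ) (v : ℝ) (j : Fin (n + 1)) :
    (Fin (n + 1) → ℝ) → (Fin (n + 1) → ℝ) :=
  fun x => x - (∑ i, Cmat n v i j * x i) • (Pi.single j 1 : Fin (n + 1) → ℝ)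

/-- `ρ_v(w) = σ_{j_1} ∘ ⋯ ∘ σ_{j_r}` for a word `w = (j_1, …, j_r)`. -/
noncomputable def rhoV (n : ℕ) (v : ℝ) : List (Fin (n + 1)) → (Fin (n + 1) → ℝ) → (Fin (n + 1) → ℝ)
  | [] => id
  | j :: w => sigmaV n v j ∘ rhoV n v w

lemma qint_zero (v : ℝ) : qint v 0 = 0 := by simp [qint]

lemma qint_sub_ne {v : ℝ} (hv : 0 < v) (h : v ≠ 1) : v - v⁻¹ ≠ 0 := by
  intro h0
  have h1 : v * v = 1 := by
    have : v = v⁻¹ := by linarith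
    nth_rewrite 2 [this]
    exact mul_inv_cancel₀ hv.ne'
  apply h
  nlinarith

lemma qint_one {v : ℝ} (hv : 0 < v) : qint v 1 = 1 := by
  unfold qint
  split_ifs with h
  · simp
  · have := qint_sub_ne hv h
    simp [div_self this]

lemma qint_neg (v : ℝ) (k : ℤ) : qint v (-k) = - qint v k := by
  unfold qint
  split_ifs with h
  · simp
  · rw [neg_neg, ← neg_div]; ring

lemma qint_rec {v : ℝ} (hv : 0 < v) (k : ℤ) :
    qint v (k + 2) = (v + v⁻¹) * qint v (k + 1) - qint v k := by
  unfold qint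
  split_ifs with h
  · subst h; push_cast; ring
  · have h1 := qint_sub_ne hv h
    have h0 := hv.ne'
    rw [neg_add, neg_add, zpow_add₀ h0, zpow_add₀ h0, zpow_add₀ h0, zpow_add₀ h0]
    have e2 : v ^ (-2 : ℤ) = v⁻¹ * v⁻¹ := by
      rw [zpow_neg]; rw [← mul_inv]; congr 1; norm_cast; ring
    have e3 : v ^ (2 : ℤ) = v * v := by norm_cast; ring
    have e4 : v * v⁻¹ = 1 := mul_inv_cancel₀ h0
    rw [e2, e3, zpow_one, zpow_neg_one, mul_div_assoc', div_sub_div_same]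
    congr 1
    generalize v ^ k = a at *
    generalize v ^ (-k) = b at *
    generalize v⁻¹ = w at *
    linear_combination (-a + b) * e4

/-- Coordinates of the root `x(i,j,k)`. -/
noncomputable def rootG (v : ℝ) (i j : ℕ) (k : ℤ) (p : ℕ) : ℝ :=
  if p = 0 then qint v k else if p < i then v * qint v k
    else if p ≤ j then qint v (k + 1) else v⁻¹ * qint v k

/-- The root `x(i,j,k)`. -/
noncomputable def rootX (n : ℕ) (v : ℝ) (i j : ℕ) (k : ℤ) : Fin (n + 1) → ℝ :=
  fun p => rootG v i j k p

lemma rootX_eq (n : ℕ) (v : ℝ) (i j : ℕ) (k : ℤ) (hi : 1 ≤ i) (hij : i ≤ j) :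
    qint v (k + 1) • alphaIJ n i j + qint v k • alphaIJ' n v i j = rootX n v i j k := by
  funext p
  simp only [rootX, rootG, alphaIJ, alphaIJ', Pi.add_apply, Pi.smul_apply, smul_eq_mul]
  split_ifs <;> first | omega | ring

lemma mem_Phi (n : ℕ) (v : ℝ) (x : Fin (n + 1) → ℝ) :
    x ∈ Phi n v ↔ ∃ (i j : ℕ) (k m : ℤ) (η : ℝ), 1 ≤ i ∧ i ≤ j ∧ j ≤ n ∧ (η = 1 ∨ η = -1) ∧
      x = (η * v ^ m) • rootX n v i j k := by
  simp only [Phi, Set.mem_iUnion, PhiIJ, Set.mem_setOf_eq]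
  constructor
  · rintro ⟨i, j, hi, hij, hj, η, m, k, hη, rfl⟩
    exact ⟨i, j, k, m, η, hi, hij, hj, hη, by rw [rootX_eq n v i j k hi hij]⟩
  · rintro ⟨i, j, k, m, η, hi, hij, hj, hη, rfl⟩
    exact ⟨i, j, hi, hij, hj, η, m, k, hη, by rw [rootX_eq n v i j k hi hij]⟩

/-- New coordinate at `l` after applying `σ_l`. -/
noncomputable def newC (n : ℕ) (v : ℝ) (g : ℕ → ℝ) (l : ℕ) : ℝ :=
  if l = 0 then v⁻¹ * g 1 + v * g n - g 0
  else (if l = 1 then v * g 0 else g (l - 1)) + (if l = n then v⁻¹ * g 0 else g (l + 1)) - g l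

lemma sum_pick (n : ℕ) (g : ℕ → ℝ) (a b c : ℕ) (ha : a ≤ n) (hb : b ≤ n) (hc : c ≤ n)
    (r s t : ℝ) :
    ∑ i : Fin (n + 1), ((if (i : ℕ) = a then r else 0) + (if (i : ℕ) = b then s else 0)
      + (if (i : ℕ) = c then t else 0)) * g i = r * g a + s * g b + t * g c := by
  rw [Fin.sum_univ_eq_sum_range (fun i : ℕ => ((if i = a then r else 0) + (if i = b then s else 0)
      + (if i = c then t else 0)) * g i)]
  simp only [add_mul, Finset.sum_add_distrib, ite_mul, zero_mul, Finset.sum_ite_eq',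
    Finset.mem_range]
  rw [if_pos (by omega), if_pos (by omega), if_pos (by omega)]

lemma sigmaV_apply (n : ℕ) (hn : 2 ≤ n) (v : ℝ) (g : ℕ → ℝ) (l : Fin (n + 1)) :
    sigmaV n v l (fun p => g p) = fun p : Fin (n + 1) =>
      if (p : ℕ) = (l : ℕ) then newC n v g l else g p := by
  have key : ∑ i, Cmat n v i l * g i = g l - newC n v g l := by
    obtain ⟨l, hl⟩ := l
    by_cases h0 : l = 0
    · subst h0
      rw [Finset.sum_congr rfl (fun i _ => ?_), sum_pick n g 0 1 n (by omega) (by omega) le_rfl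
        2 (-v⁻¹) (-v)]
      · simp [newC]; ring
      · congr 1
        simp only [Cmat, Matrix.of_apply, Fin.ext_iff]
        split_ifs <;> first | contradiction | omega | (simp; done) | (exfalso; simp_all; done) | (exfalso; simp_all; omega)
    · rw [Finset.sum_congr rfl (fun i _ => ?_), sum_pick n g l (l - 1) (if l = n then 0 else l + 1)
        (by omega) (by omega) (by split_ifs <;> omega)
        2 (if l = 1 then -v else -1) (if l = n then -v⁻¹ else -1)]
      · simp only [newC, if_neg h0]
        split_ifs <;> (try subst l) <;> first | omega | (simp; ring)
      · congr 1
        simp only [Cmat, Matrix.of_apply, Fin.ext_iff]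
        split_ifs <;> first | omega | simp
  funext p
  simp only [sigmaV, key, Pi.sub_apply, Pi.smul_apply, Pi.single_apply, Fin.ext_iff, smul_eq_mul]
  split_ifs with h
  · rw [h]; ring
  · ring

lemma sigmaV_smul (n : ℕ) (v : ℝ) (l : Fin (n + 1)) (a : ℝ) (x : Fin (n + 1) → ℝ) :
    sigmaV n v l (a • x) = a • sigmaV n v l x := by
  simp only [sigmaV, smul_sub, smul_smul, Pi.smul_apply, smul_eq_mul, Finset.mul_sum]
  congr 3
  funext i
  ring

lemma rhoV_smul (n : ℕ) (v : ℝ) (w : List (Fin (n + 1))) (a : ℝ) (x : Fin (n + 1) → ℝ) :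
    rhoV n v w (a • x) = a • rhoV n v w x := by
  induction w with
  | nil => rfl
  | cons l w ih => simp only [rhoV, Function.comp_apply, ih, sigmaV_smul]

lemma rhoV_append (n : ℕ) (v : ℝ) (w w' : List (Fin (n + 1))) (x : Fin (n + 1) → ℝ) :
    rhoV n v (w ++ w') x = rhoV n v w (rhoV n v w' x) := by
  induction w with
  | nil => rfl
  | cons l w ih => simp only [List.cons_append, rhoV, Function.comp_apply, ih]

section moves

variable {n : ℕ} (hn : 2 ≤ n) {v : ℝ} (hv : 0 < v) {i j : ℕ} (hi : 1 ≤ i) (hij : i ≤ j)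
  (hj : j ≤ n) (k : ℤ)

lemma sigma_rootX (hn : 2 ≤ n) (v : ℝ) (i j : ℕ) (k : ℤ) (l : Fin (n + 1)) :
    sigmaV n v l (rootX n v i j k) = fun p : Fin (n + 1) =>
      if (p : ℕ) = (l : ℕ) then newC n v (rootG v i j k) l else rootG v i j k p :=
  sigmaV_apply n hn v (rootG v i j k) l

/-- Extended coordinates without the special value at zero. -/
noncomputable def rootH (v : ℝ) (i j : ℕ) (k : ℤ) (p : ℕ) : ℝ :=
  if p < i then v * qint v k else if p ≤ j then qint v (k + 1) else v⁻¹ * qint v k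

lemma rootG_eq_rootH (v : ℝ) (i j : ℕ) (k : ℤ) (p : ℕ) (hp : p ≠ 0) :
    rootG v i j k p = rootH v i j k p := by
  simp only [rootG, rootH, if_neg hp]

lemma newC_rootG (hi : 1 ≤ i) (hI : i ≤ n) (hj : j ≤ n) (l : ℕ) (hl : l ≠ 0) :
    newC n v (rootG v i j k) l =
      rootH v i j k (l - 1) + rootH v i j k (l + 1) - rootH v i j k l := by
  have e1 : (if l = 1 then v * rootG v i j k 0 else rootG v i j k (l - 1)) =
      rootH v i j k (l - 1) := by
    split_ifs with h
    · subst h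
      simp only [rootG, rootH, if_pos]
      rw [if_pos (by omega)]
    · exact rootG_eq_rootH _ _ _ _ _ (by omega)
  have e2 : (if l = n then v⁻¹ * rootG v i j k 0 else rootG v i j k (l + 1)) =
      rootH v i j k (l + 1) := by
    split_ifs with h
    · subst h
      simp only [rootG, rootH, if_pos]
      split_ifs with h1 h2
      · -- only when `i` is out of range
        exact absurd hI (by omega)
      · omega
      · rfl
    · exact rootG_eq_rootH _ _ _ _ _ (by omega)
  rw [newC, if_neg hl, e1, e2, rootG_eq_rootH _ _ _ _ _ hl]

/-- Pointwise criterion. -/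
lemma sigma_eq_of (hn : 2 ≤ n) (hi : 1 ≤ i) (hI : i ≤ n) (hj : j ≤ n) (l : Fin (n + 1))
    (hl : (l : ℕ) ≠ 0) (y : Fin (n + 1) → ℝ)
    (h1 : y l = rootH v i j k (l - 1) + rootH v i j k (l + 1) - rootH v i j k l)
    (h2 : ∀ p : Fin (n + 1), (p : ℕ) ≠ l → y p = rootG v i j k p) :
    sigmaV n v l (rootX n v i j k) = y := by
  rw [sigma_rootX hn]
  funext p
  split_ifs with h
  · rw [newC_rootG k hi hI hj _ hl, ← h1, Fin.ext h]
  · exact (h2 p h).symm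

lemma move_i_down (hn : 2 ≤ n) (hi : 2 ≤ i) (hij : i ≤ j) (hj : j ≤ n) (l : Fin (n + 1))
    (hl : (l : ℕ) + 1 = i) :
    sigmaV n v l (rootX n v i j k) = rootX n v (i - 1) j k := by
  refine sigma_eq_of k hn (by omega) (by omega) (by omega) l (by omega) _ ?_ (fun p hp => ?_)
  · simp only [rootX, rootG, rootH]
    split_ifs <;> first | omega | ring1
  · simp only [rootX, rootG]
    split_ifs <;> first | omega | ring1

lemma move_i_up (hn : 2 ≤ n) (hi : 1 ≤ i) (hij : i < j) (hj : j ≤ n) (l : Fin (n + 1))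
    (hl : (l : ℕ) = i) :
    sigmaV n v l (rootX n v i j k) = rootX n v (i + 1) j k := by
  refine sigma_eq_of k hn (by omega) (by omega) (by omega) l (by omega) _ ?_ (fun p hp => ?_)
  · simp only [rootX, rootG, rootH]
    split_ifs <;> first | omega | ring1
  · simp only [rootX, rootG]
    split_ifs <;> first | omega | ring1

lemma move_j_up (hn : 2 ≤ n) (hi : 1 ≤ i) (hij : i ≤ j) (hj : j < n) (l : Fin (n + 1))
    (hl : (l : ℕ) = j + 1) :
    sigmaV n v l (rootX n v i j k) = rootX n v i (j + 1) k := by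
  refine sigma_eq_of k hn (by omega) (by omega) (by omega) l (by omega) _ ?_ (fun p hp => ?_)
  · simp only [rootX, rootG, rootH]
    split_ifs <;> first | omega | ring1
  · simp only [rootX, rootG]
    split_ifs <;> first | omega | ring1

lemma move_j_down (hn : 2 ≤ n) (hi : 1 ≤ i) (hij : i < j) (hj : j ≤ n) (l : Fin (n + 1))
    (hl : (l : ℕ) = j) :
    sigmaV n v l (rootX n v i j k) = rootX n v i (j - 1) k := by
  refine sigma_eq_of k hn (by omega) (by omega) (by omega) l (by omega) _ ?_ (fun p hp => ?_)
  · simp only [rootX, rootG, rootH]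
    split_ifs <;> first | omega | ring1
  · simp only [rootX, rootG]
    split_ifs <;> first | omega | ring1

lemma move_diag (hn : 2 ≤ n) (hv : 0 < v) (hi : 1 ≤ i) (hj : i ≤ n) (l : Fin (n + 1))
    (hl : (l : ℕ) = i) :
    sigmaV n v l (rootX n v i i k) = (-1 : ℝ) • rootX n v i i (-k) := by
  have h1 : qint v (-k) = - qint v k := qint_neg v k
  have h2 : qint v (-k + 1) = - qint v (k - 1) := by
    rw [← qint_neg]; congr 1; ring
  have h3 := qint_rec hv (k - 1)
  rw [show k - 1 + 2 = k + 1 by ring, show k - 1 + 1 = k by ring] at h3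
  refine sigma_eq_of k hn (by omega) (by omega) (by omega) l (by omega) _ ?_ (fun p hp => ?_)
  · simp only [rootX, rootG, rootH, Pi.smul_apply, smul_eq_mul, h1, h2, h3]
    split_ifs <;> first | omega | ring1
  · simp only [rootX, rootG, Pi.smul_apply, smul_eq_mul, h1, h2, h3]
    split_ifs <;> first | omega | ring1

lemma move_fix (hn : 2 ≤ n) (hi : 1 ≤ i) (hij : i ≤ j) (hj : j ≤ n) (l : Fin (n + 1))
    (h0 : (l : ℕ) ≠ 0) (h1 : (l : ℕ) ≠ i) (h2 : (l : ℕ) ≠ j) (h3 : (l : ℕ) + 1 ≠ i)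
    (h4 : (l : ℕ) ≠ j + 1) :
    sigmaV n v l (rootX n v i j k) = rootX n v i j k := by
  refine sigma_eq_of k hn (by omega) (by omega) (by omega) l (by omega) _ ?_ (fun p hp => ?_)
  · simp only [rootX, rootG, rootH]
    split_ifs <;> first | omega | ring1
  · simp only [rootX, rootG]

lemma move_fix0 (hn : 2 ≤ n) (hv : 0 < v) (hi : 2 ≤ i) (hij : i ≤ j) (hj : j < n) :
    sigmaV n v 0 (rootX n v i j k) = rootX n v i j k := by
  rw [sigma_rootX hn]
  have hv0 := hv.ne'
  funext p
  simp only [rootX, rootG, newC, Fin.val_zero]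
  split_ifs <;> first | contradiction | omega | (field_simp; done) | (field_simp; ring1)

lemma move0_left (hn : 2 ≤ n) (hv : 0 < v) (hij : 1 ≤ j) (hj : j < n) :
    sigmaV n v 0 (rootX n v 1 j k) = (-1 * v ^ (-1 : ℤ)) • rootX n v (j + 1) n (-k - 1) := by
  rw [sigma_rootX hn]
  have hv0 := hv.ne'
  have h1 : qint v (-k - 1) = - qint v (k + 1) := by rw [← qint_neg]; congr 1; ring
  have h2 : qint v (-k - 1 + 1) = - qint v k := by rw [← qint_neg]; congr 1; ring
  funext p
  have := p.2
  simp only [rootX, rootG, newC, Fin.val_zero, Pi.smul_apply, smul_eq_mul, h1, h2, zpow_neg_one]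
  split_ifs <;> first | contradiction | omega | (field_simp; done) | (field_simp; ring1)

lemma move0_right (hn : 2 ≤ n) (hv : 0 < v) (hi : 2 ≤ i) (hj : i ≤ n) :
    sigmaV n v 0 (rootX n v i n k) = (-1 * v ^ (1 : ℤ)) • rootX n v 1 (i - 1) (-k - 1) := by
  rw [sigma_rootX hn]
  have hv0 := hv.ne'
  have h1 : qint v (-k - 1) = - qint v (k + 1) := by rw [← qint_neg]; congr 1; ring
  have h2 : qint v (-k - 1 + 1) = - qint v k := by rw [← qint_neg]; congr 1; ring
  funext p
  have := p.2
  simp only [rootX, rootG, newC, Fin.val_zero, Pi.smul_apply, smul_eq_mul, h1, h2, zpow_one]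
  split_ifs <;> first | contradiction | omega | (field_simp; done) | (field_simp; ring1)

lemma move0_full (hn : 2 ≤ n) (hv : 0 < v) :
    sigmaV n v 0 (rootX n v 1 n k) = (-1 : ℝ) • rootX n v 1 n (-k - 2) := by
  rw [sigma_rootX hn]
  have h1 : qint v (-k - 2) = - qint v (k + 2) := by rw [← qint_neg]; congr 1; ring
  have h2 : qint v (-k - 2 + 1) = - qint v (k + 1) := by rw [← qint_neg]; congr 1; ring
  rw [qint_rec hv] at h1
  funext p
  have := p.2
  simp only [rootX, rootG, newC, Fin.val_zero, Pi.smul_apply, smul_eq_mul, h1, h2]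
  split_ifs <;> first | contradiction | omega | ring1

end moves

lemma rootX_simple (n : ℕ) {v : ℝ} (hv : 0 < v) (i : Fin (n + 1)) (h : (i : ℕ) ≠ 0) :
    rootX n v i i 0 = Pi.single i 1 := by
  funext p
  simp only [rootX, rootG, Pi.single_apply, Fin.ext_iff, qint_zero, zero_add, qint_one hv]
  split_ifs <;> first | omega | simp

lemma rootX_zero (n : ℕ) {v : ℝ} (hv : 0 < v) :
    (-1 : ℝ) • rootX n v 1 n (-1) = Pi.single 0 1 := by
  funext p
  have := p.2
  simp only [rootX, rootG, Pi.single_apply, Fin.ext_iff, Fin.val_zero, Pi.smul_apply, smul_eq_mul,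
    neg_add_cancel, qint_neg, qint_zero, qint_one hv]
  split_ifs <;> first | omega | simp

lemma sigma_mem_Phi {n : ℕ} (hn : 2 ≤ n) {v : ℝ} (hv : 0 < v) (l : Fin (n + 1))
    {x : Fin (n + 1) → ℝ} (hx : x ∈ Phi n v) : sigmaV n v l x ∈ Phi n v := by
  rw [mem_Phi] at hx ⊢
  obtain ⟨i, j, k, m, η, hi, hij, hj, hη, rfl⟩ := hx
  suffices H : ∃ (i' j' : ℕ) (k' m' : ℤ) (η' : ℝ), 1 ≤ i' ∧ i' ≤ j' ∧ j' ≤ n ∧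
      (η' = 1 ∨ η' = -1) ∧
      sigmaV n v l (rootX n v i j k) = (η' * v ^ m') • rootX n v i' j' k' by
    obtain ⟨i', j', k', m', η', h1, h2, h3, h4, h5⟩ := H
    refine ⟨i', j', k', m + m', η * η', h1, h2, h3, ?_, ?_⟩
    · rcases hη with rfl | rfl <;> rcases h4 with rfl | rfl <;> simp
    · rw [sigmaV_smul, h5, smul_smul, zpow_add₀ hv.ne']
      congr 1; ring
  by_cases h0 : l = 0
  · subst h0
    by_cases h1 : i = 1
    · subst h1
      by_cases h2 : j = n
      · subst h2
        exact ⟨1, j, -k - 2, 0, -1, le_rfl, hij, le_rfl, Or.inr rfl, by simp [move0_full k hn hv]⟩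
      · exact ⟨j + 1, n, -k - 1, -1, -1, by omega, by omega, le_rfl, Or.inr rfl,
          move0_left k hn hv hij (by omega)⟩
    · by_cases h2 : j = n
      · subst h2
        exact ⟨1, i - 1, -k - 1, 1, -1, by omega, by omega, by omega, Or.inr rfl,
          move0_right k hn hv (by omega) hij⟩
      · exact ⟨i, j, k, 0, 1, hi, hij, hj, Or.inl rfl, by
          simp [move_fix0 k hn hv (show 2 ≤ i by omega) hij (show j < n by omega)]⟩
  · have h0 : (l : ℕ) ≠ 0 := fun h => h0 (Fin.ext h)
    by_cases c1 : (l : ℕ) + 1 = i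
    · exact ⟨i - 1, j, k, 0, 1, by omega, by omega, hj, Or.inl rfl, by
        simp [move_i_down k hn (by omega) hij hj l c1]⟩
    by_cases c2 : (l : ℕ) = j + 1
    · exact ⟨i, j + 1, k, 0, 1, hi, by omega, by omega, Or.inl rfl, by
        simp [move_j_up k hn hi hij (by omega) l c2]⟩
    by_cases c3 : (l : ℕ) = i
    · rcases hij.lt_or_eq with h | h
      · exact ⟨i + 1, j, k, 0, 1, by omega, by omega, hj, Or.inl rfl, by
          simp [move_i_up k hn hi h hj l c3]⟩
      · subst h
        exact ⟨i, i, -k, 0, -1, hi, le_rfl, hj, Or.inr rfl, by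
          simp [move_diag k hn hv hi hj l c3]⟩
    by_cases c4 : (l : ℕ) = j
    · exact ⟨i, j - 1, k, 0, 1, by omega, by omega, by omega, Or.inl rfl, by
          simp [move_j_down k hn hi (show i < j by omega) hj l c4]⟩
    · exact ⟨i, j, k, 0, 1, hi, hij, hj, Or.inl rfl, by
          simp [move_fix k hn hi hij hj l h0 c3 c4 c1 c2]⟩

/-- The orbit. -/
def Orb (n : ℕ) (v : ℝ) : Set (Fin (n + 1) → ℝ) :=
  { x : Fin (n + 1) → ℝ | ∃ (w : List (Fin (n + 1))) (i : Fin (n + 1)),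
        x = rhoV n v w (Pi.single i 1) }

lemma Orb_sigma {n : ℕ} {v : ℝ} {x : Fin (n + 1) → ℝ} (hx : x ∈ Orb n v) (l : Fin (n + 1)) :
    sigmaV n v l x ∈ Orb n v := by
  obtain ⟨w, i, rfl⟩ := hx
  exact ⟨l :: w, i, rfl⟩

lemma Orb_smul_sigma {n : ℕ} {v a : ℝ} {x : Fin (n + 1) → ℝ} (hx : a • x ∈ Orb n v)
    (l : Fin (n + 1)) : a • sigmaV n v l x ∈ Orb n v := by
  rw [← sigmaV_smul]
  exact Orb_sigma hx l

/-- Moving `i` and `j` freely inside the orbit. -/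
lemma Orb_ij {n : ℕ} (hn : 2 ≤ n) {v : ℝ} (a : ℝ) (k : ℤ) {i j : ℕ} (hi : 1 ≤ i) (hij : i ≤ j)
    (hj : j ≤ n) : a • rootX n v i j k ∈ Orb n v ↔ a • rootX n v 1 n k ∈ Orb n v := by
  have A : ∀ d j : ℕ, ∀ i, 1 ≤ i → i ≤ j → j + d = n →
      (a • rootX n v i j k ∈ Orb n v ↔ a • rootX n v i n k ∈ Orb n v) := by
    intro d
    induction d with
    | zero => intro j i _ _ h; rw [show j = n by omega]
    | succ d ih =>
      intro j i h1 h2 h3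
      rw [← ih (j + 1) i h1 (by omega) (by omega)]
      constructor
      · intro h
        rw [← move_j_up k hn h1 h2 (by omega) ⟨j + 1, by omega⟩ rfl]
        exact Orb_smul_sigma h _
      · intro h
        have := Orb_smul_sigma h ⟨j + 1, by omega⟩
        rwa [move_j_down (j := j + 1) k hn h1 (by omega) (by omega) _ rfl,
          Nat.add_sub_cancel] at this
  have B : ∀ i, i + 1 ≤ n →
      (a • rootX n v (i + 1) n k ∈ Orb n v ↔ a • rootX n v 1 n k ∈ Orb n v) := by
    intro i
    induction i with
    | zero => intro _; rfl
    | succ i ih =>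
      intro h3
      rw [← ih (by omega)]
      constructor
      · intro h
        have := Orb_smul_sigma h ⟨i + 1, by omega⟩
        rwa [move_i_down (i := i + 1 + 1) (j := n) k hn (by omega) (by omega) (by omega) _ rfl,
          Nat.add_sub_cancel] at this
      · intro h
        rw [← move_i_up (i := i + 1) (j := n) k hn (by omega) (by omega) (by omega)
          ⟨i + 1, by omega⟩ rfl]
        exact Orb_smul_sigma h _
  rw [A (n - j) j i hi hij (by omega)]
  have := B (i - 1) (by omega)
  rwa [Nat.sub_add_cancel hi] at this

/-- `a • x(1,n,k)` lies in the orbit. -/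
def InOrb (n : ℕ) (v a : ℝ) (k : ℤ) : Prop := a • rootX n v 1 n k ∈ Orb n v

section

variable {n : ℕ} {v a : ℝ} {k : ℤ}

lemma InOrb.neg (hn : 2 ≤ n) (hv : 0 < v) (h : InOrb n v a k) : InOrb n v (-a) (-k) := by
  have h1 := (Orb_ij hn a k le_rfl le_rfl (show 1 ≤ n by omega)).2 h
  have h2 := Orb_smul_sigma h1 ⟨1, by omega⟩
  rw [move_diag k hn hv le_rfl (by omega) _ rfl, smul_smul,
    Orb_ij hn _ _ le_rfl le_rfl (by omega), mul_neg_one] at h2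
  exact h2

lemma InOrb.left (hn : 2 ≤ n) (hv : 0 < v) (h : InOrb n v a k) :
    InOrb n v (-(a * v⁻¹)) (-k - 1) := by
  have h1 := (Orb_ij hn a k le_rfl le_rfl (show 1 ≤ n by omega)).2 h
  have h2 := Orb_smul_sigma h1 0
  rw [move0_left k hn hv le_rfl (by omega), smul_smul,
    Orb_ij hn _ _ (by omega) (by omega) le_rfl, zpow_neg_one] at h2
  rw [show -(a * v⁻¹) = a * (-1 * v⁻¹) by ring]
  exact h2

lemma InOrb.right (hn : 2 ≤ n) (hv : 0 < v) (h : InOrb n v a k) :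
    InOrb n v (-(a * v)) (-k - 1) := by
  have h1 := (Orb_ij hn a k (show 1 ≤ n by omega) le_rfl le_rfl).2 h
  have h2 := Orb_smul_sigma h1 0
  rw [move0_right k hn hv hn (by omega), smul_smul,
    Orb_ij hn _ _ (by omega) (by omega) (by omega), zpow_one] at h2
  rw [show -(a * v) = a * (-1 * v) by ring]
  exact h2

lemma InOrb.full (hn : 2 ≤ n) (hv : 0 < v) (h : InOrb n v a k) : InOrb n v (-a) (-k - 2) := by
  have h2 := Orb_smul_sigma h 0
  rw [move0_full k hn hv, smul_smul, mul_neg_one] at h2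
  exact h2

lemma InOrb.up (hn : 2 ≤ n) (hv : 0 < v) (h : InOrb n v a k) (p : ℤ) :
    InOrb n v (a * v ^ p) (k + p) := by
  have h0 := hv.ne'
  induction p with
  | zero => simpa using h
  | succ p ih =>
    have := (ih.right hn hv).neg hn hv
    convert this using 1
    · rw [zpow_add_one₀ h0]; ring
    · ring
  | pred p ih =>
    have := (ih.neg hn hv).left hn hv
    convert this using 1
    · rw [zpow_sub_one₀ h0]; ring
    · ring

lemma InOrb.down (hn : 2 ≤ n) (hv : 0 < v) (h : InOrb n v a k) (p : ℤ) :
    InOrb n v (a * v ^ p) (k - p) := by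
  have h0 := hv.ne'
  induction p with
  | zero => simpa using h
  | succ p ih =>
    have := (ih.neg hn hv).right hn hv
    convert this using 1
    · rw [zpow_add_one₀ h0]; ring
    · ring
  | pred p ih =>
    have := (ih.left hn hv).neg hn hv
    convert this using 1
    · rw [zpow_sub_one₀ h0]; ring
    · ring

lemma InOrb.translate (hn : 2 ≤ n) (hv : 0 < v) (h : InOrb n v a k) (r s : ℤ)
    (hrs : (r + s) % 2 = 0) : InOrb n v (a * v ^ r) (k + s) := by
  have := (h.up hn hv ((r + s) / 2)).down hn hv (r - (r + s) / 2)
  convert this using 1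
  · rw [mul_assoc, ← zpow_add₀ hv.ne']; congr 2; ring
  · omega

lemma InOrb_all (hn : 2 ≤ n) (hv : 0 < v) (η : ℝ) (hη : η = 1 ∨ η = -1) (m k : ℤ) :
    InOrb n v (η * v ^ m) k := by
  have h0 : InOrb n v 1 0 := by
    rw [InOrb, ← Orb_ij hn 1 0 le_rfl le_rfl (show 1 ≤ n by omega), one_smul]
    exact ⟨[], ⟨1, by omega⟩, rootX_simple n hv ⟨1, by omega⟩ one_ne_zero⟩
  have h1 : InOrb n v (-1) (-1) := ⟨[], 0, rootX_zero n hv⟩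
  have a0 : InOrb n v η 0 := by
    rcases hη with rfl | rfl
    · exact h0
    · simpa using h0.neg hn hv
  have a1 : InOrb n v η (-1) := by
    rcases hη with rfl | rfl
    · simpa using h1.full hn hv
    · exact h1
  by_cases h : (m + k) % 2 = 0
  · simpa using a0.translate hn hv m k h
  · simpa using a1.translate hn hv m (k + 1) (by omega)

end

/-- the orbit of the standard basis vectors `α_0, …, α_n` under the
subgroup of `GL(ℝ^{n+1})` generated by the (involutive) reflections `σ_0, …, σ_n`
(equivalently, the set of all images of the `α_i` under arbitrary finite products of
the `σ_j`) equals `Φ(n,v)`. -/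
theorem orbit_eq_Phi (n : ℕ) (hn : 2 ≤ n) (v : ℝ) (hv : 0 < v) :
    { x : Fin (n + 1) → ℝ | ∃ (w : List (Fin (n + 1))) (i : Fin (n + 1)),
        x = rhoV n v w (Pi.single i 1) } = Phi n v := by
  apply Set.Subset.antisymm
  · rintro x ⟨w, i, rfl⟩
    induction w with
    | nil =>
      rw [mem_Phi]
      by_cases h : (i : ℕ) = 0
      · have h : i = 0 := Fin.ext h
        subst h
        exact ⟨1, n, -1, 0, -1, le_rfl, by omega, le_rfl, Or.inr rfl, by
          simpa [rhoV] using (rootX_zero n hv).symm⟩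
      · exact ⟨i, i, 0, 0, 1, by omega, le_rfl, by omega, Or.inl rfl, by
          simpa [rhoV] using (rootX_simple n hv i h).symm⟩
    | cons l w ih => exact sigma_mem_Phi hn hv l ih
  · intro x hx
    rw [mem_Phi] at hx
    obtain ⟨i, j, k, m, η, hi, hij, hj, hη, rfl⟩ := hx
    exact (Orb_ij hn _ k hi hij hj).2 (InOrb_all hn hv η hη m k)
end

section
/- Let n ≥ 2 be an integer and v > 0 a real number. The determinant of the (n+1)×(n+1) matrix C(n,v) equals −(v − v^{−1})². -/
noncomputable def Tmat (n : ℕ) : Matrix (Fin n) (Fin n) ℝ :=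
  Matrix.of fun i j =>
    if i = j then 2
    else if (i : ℕ) + 1 = (j : ℕ) ∨ (j : ℕ) + 1 = (i : ℕ) then -1
    else 0

theorem Tmat_sum (n : ℕ) (g : ℕ → ℝ) (k : Fin n) :
    ∑ i : Fin n, g (i + 1) * Tmat n k i =
      2 * g (k + 1) - g k - g (k + 2) + (if (k : ℕ) = 0 then g 0 else 0)
        + (if (k : ℕ) + 1 = n then g (n + 1) else 0) := by
  obtain ⟨k, hk⟩ := k
  have h : ∀ i : Fin n, g (i + 1) * Tmat n ⟨k, hk⟩ i =
      (fun i : ℕ => (if k = i then 2 * g (i + 1) else 0) + (if k + 1 = i then - g (i + 1) else 0)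
        + (if i + 1 = k then - g (i + 1) else 0)) i := by
    rintro ⟨i, hi⟩
    simp only [Tmat, Matrix.of_apply, Fin.mk.injEq]
    split_ifs <;> first | omega | contradiction | ring1
  rw [Finset.sum_congr rfl (fun i _ => h i), Fin.sum_univ_eq_sum_range (fun i : ℕ => (if k = i then 2 * g (i + 1) else 0) + (if k + 1 = i then - g (i + 1) else 0)
        + (if i + 1 = k then - g (i + 1) else 0))]
  simp only [Finset.sum_add_distrib, Finset.sum_ite_eq, Finset.mem_range, hk, if_true]
  have h1 : ∑ i ∈ Finset.range n, (if i + 1 = k then - g (i + 1) else 0)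
      = if k = 0 then 0 else - g k := by
    cases k with
    | zero => simp
    | succ m =>
      simp only [Nat.add_right_cancel_iff, Finset.sum_ite_eq', Finset.mem_range]
      rw [if_pos (by omega), if_neg (by omega)]
  rw [h1]
  by_cases h2 : k + 1 = n
  · subst h2
    by_cases h0 : k = 0
    · subst h0; simp; ring
    · simp [h0]; ring
  · have : k + 1 < n := by omega
    by_cases h0 : k = 0
    · subst h0; simp [h2, this]; ring
    · simp [h0, h2, this]; ring

theorem det_key {n : ℕ} (A : Matrix (Fin (n + 1)) (Fin (n + 1)) ℝ) (c : Fin (n + 1) → ℝ) (d : ℝ)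
    (h0 : ∑ i, c i * A 0 i = d) (h : ∀ k : Fin n, ∑ i, c i * A k.succ i = 0) :
    c 0 * A.det = d * (A.submatrix Fin.succ Fin.succ).det := by
  have := Matrix.det_updateCol_sum A 0 c
  rw [smul_eq_mul] at this
  rw [← this, Matrix.det_succ_column_zero, Fin.sum_univ_succ]
  simp only [smul_eq_mul, Matrix.updateCol_self, h0, h]
  simp only [mul_zero, zero_mul, Finset.sum_const_zero, add_zero, Fin.val_zero, pow_zero, one_mul]
  congr 2

theorem det_Tmat (n : ℕ) : (Tmat n).det = n + 1 := by
  induction n with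
  | zero => simp
  | succ n ih =>
    have hs : (Tmat (n + 1)).submatrix Fin.succ Fin.succ = Tmat n := by
      ext i j
      simp [Tmat, Matrix.of_apply]
    have h := det_key (Tmat (n + 1)) (fun i => (fun m : ℕ => (n : ℝ) + 2 - m) ((i : ℕ) + 1)) (n + 2)
      (by
        rw [Tmat_sum (n + 1) (fun m : ℕ => (n : ℝ) + 2 - m)]
        by_cases h : n = 0
        · subst h; norm_num
        · have h2 : ¬ (((0 : Fin (n + 1)) : ℕ) + 1 = n + 1) := by
            rw [Fin.val_zero]; omega
          rw [if_neg h2, if_pos (Fin.val_zero _)]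
          simp only [Fin.val_zero]
          push_cast
          ring)
      (by
        intro k
        rw [Tmat_sum (n + 1) (fun m : ℕ => (n : ℝ) + 2 - m)]
        have : ((k.succ : Fin (n+1)) : ℕ) ≠ 0 := by simp
        rw [if_neg this]
        split_ifs <;> push_cast <;> ring)
    rw [hs, ih] at h
    have hn : (n : ℝ) + 1 ≠ 0 := by positivity
    apply mul_left_cancel₀ hn
    push_cast at h ⊢
    simp only [Fin.val_zero] at h
    push_cast at h
    linear_combination h

/-- for `n ≥ 2` and `v > 0`, `det C(n,v) = -(v - v⁻¹)²`. -/
theorem det_Cmat (n : ℕ) (hn : 2 ≤ n) (v : ℝ) (hv : 0 < v) :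
    (Cmat n v).det = -(v - v⁻¹) ^ 2 := by
  have hs : (Cmat n v).submatrix Fin.succ Fin.succ = Tmat n := by
    ext i j
    simp [Tmat, Cmat, Matrix.of_apply]
  have hs' : ∀ i j : Fin n, Cmat n v i.succ j.succ = Tmat n i j := fun i j => by rw [← hs]; rfl
  have hv' : v * v⁻¹ = 1 := mul_inv_cancel₀ hv.ne'
  let g : ℕ → ℝ := fun m => (n + 1) * v⁻¹ + m * (v - v⁻¹)
  have h := det_key (Cmat n v) (Fin.cons ((n : ℝ) + 1) (fun i : Fin n => g (i + 1)))
    (2 * (n + 1) - v * g 1 - v⁻¹ * g n)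
    (by
      rw [Fin.sum_univ_succ]
      simp only [Fin.cons_zero, Fin.cons_succ]
      have h : ∀ i : Fin n, g (i + 1) * Cmat n v 0 i.succ =
          (fun i : ℕ => (if 0 = i then - v * g (i + 1) else 0)
            + (if n - 1 = i then - v⁻¹ * g (i + 1) else 0)) i := by
        rintro ⟨i, hi⟩
        simp only [Cmat, Matrix.of_apply, Fin.ext_iff, Fin.val_zero, Fin.val_succ,
          Nat.add_eq_zero_iff, one_ne_zero, and_false, false_and, true_and, and_true, or_false, false_or, if_false]
        split_ifs <;> first | omega | contradiction | ring1
      rw [Finset.sum_congr rfl (fun i _ => h i), Fin.sum_univ_eq_sum_range (fun i : ℕ => (if 0 = i then - v * g (i + 1) else 0)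
            + (if n - 1 = i then - v⁻¹ * g (i + 1) else 0))]
      simp only [Finset.sum_add_distrib, Finset.sum_ite_eq, Finset.mem_range]
      rw [if_pos (by omega), if_pos (by omega), Nat.sub_add_cancel (by omega)]
      simp [Cmat]
      ring)
    (by
      intro k
      rw [Fin.sum_univ_succ]
      simp only [Fin.cons_zero, Fin.cons_succ, hs']
      rw [Tmat_sum n g]
      have hc : Cmat n v k.succ 0 = (if (k : ℕ) = 0 then -v⁻¹ else 0)
          + (if (k : ℕ) + 1 = n then -v else 0) := by
        simp only [Cmat, Matrix.of_apply, Fin.ext_iff, Fin.val_zero, Fin.val_succ,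
          Nat.add_eq_zero_iff, one_ne_zero, and_false, false_and, true_and, and_true, or_false, false_or, if_false]
        split_ifs <;> first | omega | contradiction | ring1
      rw [hc]
      simp only [g]
      split_ifs <;> push_cast <;> ring)
  rw [hs, det_Tmat] at h
  have hn : (n : ℝ) + 1 ≠ 0 := by positivity
  apply mul_left_cancel₀ hn
  simp only [Fin.cons_zero, g] at h
  rw [h]
  push_cast
  linear_combination ((n : ℝ) + 1) * (-2 * n - 2) * hv'
end

section
/- Let n ≥ 2 be an integer and v > 0 a real number. The sets Φ_{i,j}(n,v) ⊆ ℝ^{n+1}, for 1 ≤ i ≤ j ≤ n, are pairwise disjoint: if (i,j) ≠ (p,q) with 1 ≤ i ≤ j ≤ n and 1 ≤ p ≤ q ≤ n, then Φ_{i,j}(n,v) ∩ Φ_{p,q}(n,v) = ∅. -/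
theorem qint_succ_sub (v : ℝ) (hv : 0 < v) (k : ℤ) :
    qint v (k + 1) - v * qint v k = v ^ (-k) ∧ qint v (k + 1) - v⁻¹ * qint v k = v ^ k := by
  unfold qint
  by_cases h1 : v = 1
  · subst h1
    simp
  · have hv0 : v ≠ 0 := hv.ne'
    have hd : v - v⁻¹ ≠ 0 := by
      intro h
      have h2 : v * v = 1 := by
        have : v = v⁻¹ := by linarith
        nth_rewrite 2 [this]
        exact mul_inv_cancel₀ hv0
      exact h1 (by nlinarith)
    have e : v * v⁻¹ = 1 := mul_inv_cancel₀ hv0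
    have e1 : v ^ (k + 1) = v ^ k * v := zpow_add_one₀ hv0 k
    have e2 : v ^ (-(k + 1)) = v ^ (-k) * v⁻¹ := by
      rw [neg_add, ← sub_eq_add_neg, zpow_sub_one₀ hv0]
    simp only [if_neg h1, e1, e2]
    generalize v ^ k = a
    generalize v ^ (-k) = b
    generalize v⁻¹ = w at *
    constructor
    · rw [← mul_div_assoc, ← sub_div, div_eq_iff hd]
      ring
    · rw [← mul_div_assoc, ← sub_div, div_eq_iff hd]
      ring

/-- The support interval is determined by the vector. -/
theorem mem_PhiIJ_interval (n : ℕ) (v : ℝ) (hv : 0 < v) (i j : ℕ) (hi : 1 ≤ i)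
    (x : Fin (n + 1) → ℝ) (hx : x ∈ PhiIJ n v i j) (l : Fin (n + 1)) (hl : 1 ≤ (l : ℕ)) :
    (i ≤ (l : ℕ) ∧ (l : ℕ) ≤ j) ↔ (x l ≠ v * x 0 ∧ x l ≠ v⁻¹ * x 0) := by
  obtain ⟨η, m, k, hη, rfl⟩ := hx
  have hs : η * v ^ m ≠ 0 := by
    refine mul_ne_zero ?_ (zpow_pos hv m).ne'
    rcases hη with h | h <;> rw [h] <;> norm_num
  obtain ⟨h1, h2⟩ := qint_succ_sub v hv k
  have p1 := zpow_pos hv (-k)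
  have p2 := zpow_pos hv k
  generalize η * v ^ m = s at *
  have hl0 : (l : ℕ) ≠ 0 := by omega
  have hi0 : ¬ i ≤ 0 := by omega
  simp only [alphaIJ, alphaIJ', Pi.smul_apply, Pi.add_apply, smul_eq_mul, Fin.val_zero,
    hl0, hi0, if_true, if_false, false_and]
  by_cases a : (l : ℕ) < i
  · have : ¬ i ≤ (l : ℕ) := by omega
    simp only [a, this, if_true, if_false, false_and, false_iff]
    intro h
    exact h.1 (by ring)
  · by_cases b : j < (l : ℕ)
    · have : ¬ (l : ℕ) ≤ j := by omega
      simp only [a, b, this, if_true, if_false, and_false, false_iff]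
      intro h
      exact h.2 (by ring)
    · have c1 : i ≤ (l : ℕ) := by omega
      have c2 : (l : ℕ) ≤ j := by omega
      simp only [a, b, c1, c2, if_true, if_false, and_self, true_iff]
      constructor
      · intro h
        have : s * (qint v (k + 1) - v * qint v k) = 0 := by linear_combination h
        rw [h1] at this
        exact (mul_ne_zero hs p1.ne') this
      · intro h
        have : s * (qint v (k + 1) - v⁻¹ * qint v k) = 0 := by linear_combination h
        rw [h2] at this
        exact (mul_ne_zero hs p2.ne') this

/-- the sets `Φ_{i,j}(n,v)`, for `1 ≤ i ≤ j ≤ n`, are pairwise disjoint. -/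
theorem PhiIJ_pairwise_disjoint (n : ℕ) (hn : 2 ≤ n) (v : ℝ) (hv : 0 < v)
    (i j p q : ℕ) (hi : 1 ≤ i) (hij : i ≤ j) (hj : j ≤ n)
    (hp : 1 ≤ p) (hpq : p ≤ q) (hq : q ≤ n) (hne : (i, j) ≠ (p, q)) :
    PhiIJ n v i j ∩ PhiIJ n v p q = ∅ := by
  rw [Set.eq_empty_iff_forall_notMem]
  rintro x ⟨hx, hy⟩
  have key : ∀ l : ℕ, 1 ≤ l → l ≤ n → ((i ≤ l ∧ l ≤ j) ↔ (p ≤ l ∧ l ≤ q)) := by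
    intro l h1 h2
    exact (mem_PhiIJ_interval n v hv i j hi x hx ⟨l, by omega⟩ h1).trans
      (mem_PhiIJ_interval n v hv p q hp x hy ⟨l, by omega⟩ h1).symm
  have k1 := key i hi (by omega)
  have k2 := key j (by omega) hj
  have k3 := key p hp (by omega)
  have k4 := key q (by omega) hq
  apply hne
  rw [Prod.mk.injEq]
  omega
end

section
/- Let n ≥ 2 be an integer, v > 0 a real number, and 1 ≤ i ≤ j ≤ n. The set of elements of Φ(n,v) lying in the linear span of α_{i,j} and α'_{i,j} is exactly Φ_{i,j}(n,v); that is, Φ(n,v) ∩ span_ℝ{α_{i,j}, α'_{i,j}} = Φ_{i,j}(n,v). -/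
lemma qint_succ_ne_left (v : ℝ) (hv : 0 < v) (k : ℤ) : qint v (k + 1) ≠ v * qint v k := by
  unfold qint
  split_ifs with h
  · subst h; push_cast; intro h; linarith
  · have hv0 : v ≠ 0 := hv.ne'
    have h2 : v - v⁻¹ ≠ 0 := by
      intro h3
      have h4 : v * v = 1 := by
        have : v = v⁻¹ := by linarith
        nth_rewrite 2 [this]
        exact mul_inv_cancel₀ hv0
      exact h (by nlinarith)
    have hp : v ^ (-k) ≠ 0 := zpow_ne_zero _ hv0
    intro h3
    rw [← mul_div_assoc, div_left_inj' h2, neg_add, zpow_add₀ hv0, zpow_add₀ hv0, zpow_one,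
      zpow_neg_one] at h3
    have h4 : v ^ (-k) * (v - v⁻¹) = 0 := by linear_combination h3
    exact (mul_ne_zero hp h2) h4

lemma qint_succ_ne_right (v : ℝ) (hv : 0 < v) (k : ℤ) : qint v (k + 1) ≠ v⁻¹ * qint v k := by
  unfold qint
  split_ifs with h
  · subst h; push_cast; intro h; norm_num at h
  · have hv0 : v ≠ 0 := hv.ne'
    have h2 : v - v⁻¹ ≠ 0 := by
      intro h3
      have h4 : v * v = 1 := by
        have : v = v⁻¹ := by linarith
        nth_rewrite 2 [this]
        exact mul_inv_cancel₀ hv0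
      exact h (by nlinarith)
    have hp : v ^ k ≠ 0 := zpow_ne_zero _ hv0
    intro h3
    rw [← mul_div_assoc, div_left_inj' h2, neg_add, zpow_add₀ hv0, zpow_add₀ hv0, zpow_one,
      zpow_neg_one] at h3
    have h4 : v ^ k * (v - v⁻¹) = 0 := by linear_combination h3
    exact (mul_ne_zero hp h2) h4

lemma comb_zero (n : ℕ) (v a b : ℝ) (i j : ℕ) (hi : 1 ≤ i) :
    (a • alphaIJ n i j + b • alphaIJ' n v i j) 0 = b := by
  have : ¬ i = 0 := by omega
  simp [alphaIJ, alphaIJ', this]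

lemma comb_in (n : ℕ) (v a b : ℝ) (i j l : ℕ) (hi : 1 ≤ i) (hl : l < n + 1)
    (h : i ≤ l ∧ l ≤ j) :
    (a • alphaIJ n i j + b • alphaIJ' n v i j) ⟨l, hl⟩ = a := by
  have h1 : ¬ l = 0 := by omega
  have h2 : ¬ l < i := by omega
  have h3 : ¬ j < l := by omega
  simp only [alphaIJ, alphaIJ', Pi.add_apply, Pi.smul_apply, smul_eq_mul, h, h1, h2, h3,
    and_self, if_true, if_false]
  ring

lemma comb_out (n : ℕ) (v a b : ℝ) (i j l : ℕ) (hi : 1 ≤ l) (hl : l < n + 1)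
    (h : ¬ (i ≤ l ∧ l ≤ j)) :
    (a • alphaIJ n i j + b • alphaIJ' n v i j) ⟨l, hl⟩ = v * b ∨
    (a • alphaIJ n i j + b • alphaIJ' n v i j) ⟨l, hl⟩ = v⁻¹ * b := by
  have h1 : ¬ l = 0 := by omega
  simp only [alphaIJ, alphaIJ', Pi.add_apply, Pi.smul_apply, smul_eq_mul, h, h1, if_false]
  by_cases h2 : l < i
  · left; simp only [h2, if_true]; ring
  · have h3 : j < l := by omega
    right; simp only [h2, h3, if_true, if_false]; ring

/-- `Φ(n,v) ∩ span_ℝ{α_{i,j}, α'_{i,j}} = Φ_{i,j}(n,v)`. -/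
theorem Phi_inter_span (n : ℕ) (hn : 2 ≤ n) (v : ℝ) (hv : 0 < v)
    (i j : ℕ) (hi : 1 ≤ i) (hij : i ≤ j) (hj : j ≤ n) :
    Phi n v ∩ ↑(Submodule.span ℝ {alphaIJ n i j, alphaIJ' n v i j}) = PhiIJ n v i j := by
  ext x
  constructor
  · rintro ⟨hx, hs⟩
    simp only [Phi, Set.mem_iUnion] at hx
    obtain ⟨p, q, hp, hpq, hq, hx⟩ := hx
    suffices h : p = i ∧ q = j by
      obtain ⟨rfl, rfl⟩ := h
      exact hx
    obtain ⟨η, m, k, hη, hx⟩ := hx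
    rw [SetLike.mem_coe, Submodule.mem_span_pair] at hs
    obtain ⟨a, b, hab⟩ := hs
    have hs0 : η * v ^ m ≠ 0 := by
      refine mul_ne_zero ?_ (zpow_ne_zero _ hv.ne')
      rcases hη with rfl | rfl <;> norm_num
    generalize η * v ^ m = s at hx hs0
    rw [smul_add, smul_smul, smul_smul] at hx
    have key := hab.trans hx
    have hL : s * qint v (k + 1) ≠ v * (s * qint v k) := fun h =>
      qint_succ_ne_left v hv k (mul_left_cancel₀ hs0 (by linear_combination h))
    have hR : s * qint v (k + 1) ≠ v⁻¹ * (s * qint v k) := fun h =>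
      qint_succ_ne_right v hv k (mul_left_cancel₀ hs0 (by linear_combination h))
    generalize s * qint v (k + 1) = A at *
    generalize s * qint v k = B at *
    have h0 : b = B := by
      have := congrFun key 0
      rwa [comb_zero _ _ _ _ _ _ hi, comb_zero _ _ _ _ _ _ hp] at this
    subst h0
    have sub1 : ∀ l, p ≤ l ∧ l ≤ q → i ≤ l ∧ l ≤ j := by
      intro l hl
      by_contra hc
      have hln : l < n + 1 := by omega
      have e := congrFun key ⟨l, hln⟩
      rw [comb_in n v A b p q l hp hln hl] at e
      rcases comb_out n v a b i j l (by omega) hln hc with h | h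
      · exact hL (e.symm.trans h)
      · exact hR (e.symm.trans h)
    have hA : a = A := by
      have hln : p < n + 1 := by omega
      have e := congrFun key ⟨p, hln⟩
      rwa [comb_in n v A b p q p hp hln ⟨le_rfl, hpq⟩,
        comb_in n v a b i j p hi hln (sub1 p ⟨le_rfl, hpq⟩)] at e
    subst hA
    have sub2 : ∀ l, i ≤ l ∧ l ≤ j → p ≤ l ∧ l ≤ q := by
      intro l hl
      by_contra hc
      have hln : l < n + 1 := by omega
      have e := congrFun key ⟨l, hln⟩
      rw [comb_in n v a b i j l hi hln hl] at e
      rcases comb_out n v a b p q l (by omega) hln hc with h | h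
      · exact hL (e.trans h)
      · exact hR (e.trans h)
    have := sub1 p ⟨le_rfl, hpq⟩
    have := sub1 q ⟨hpq, le_rfl⟩
    have := sub2 i ⟨le_rfl, hij⟩
    have := sub2 j ⟨hij, le_rfl⟩
    omega
  · intro hx
    refine ⟨?_, ?_⟩
    · simp only [Phi, Set.mem_iUnion]
      exact ⟨i, j, hi, hij, hj, hx⟩
    · obtain ⟨η, m, k, hη, hx⟩ := hx
      rw [SetLike.mem_coe, Submodule.mem_span_pair]
      rw [smul_add, smul_smul, smul_smul] at hx
      exact ⟨_, _, hx.symm⟩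
end

section
/- Let n ≥ 2, let v > 0 be a real number, let a_1,…,a_n be integers, and let A be a real n×n matrix such that for each column index i there are two distinct row indices r(i) ≠ s(i) with A_{r(i),i} = v^{a_i}, A_{s(i),i} = −v^{−a_i}, and all other entries of column i equal to 0. Then det(A) = 0, or there exist ε ∈ {1,−1}, an integer l, an integer m ≥ 0, and integers h_1,…,h_m such that det(A) = ε · v^l · (v − v^{−1})^m · ∏_{k=1}^m c_{h_k}. -/
def GoodDet (v x : ℝ) : Prop :=
  x = 0 ∨ ∃ (ε : ℝ) (l : ℤ) (m : ℕ) (h : Fin m → ℤ),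
      (ε = 1 ∨ ε = -1) ∧
      x = ε * v ^ l * (v - v⁻¹) ^ m * ∏ k : Fin m, qint v (h k)

theorem GoodDet.mul {v x y : ℝ} (hv : 0 < v) (hx : GoodDet v x) (hy : GoodDet v y) :
    GoodDet v (x * y) := by
  rcases hx with rfl | ⟨ε, l, m, h, hε, rfl⟩
  · left; simp
  rcases hy with rfl | ⟨ε', l', m', h', hε', rfl⟩
  · left; simp
  right
  refine ⟨ε * ε', l + l', m + m', Fin.append h h', ?_, ?_⟩
  · rcases hε with rfl | rfl <;> rcases hε' with rfl | rfl <;> simp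
  · rw [Fin.prod_univ_add, zpow_add₀ hv.ne', pow_add]
    simp only [Fin.append_left, Fin.append_right]
    ring

theorem GoodDet.one (v : ℝ) : GoodDet v 1 :=
  Or.inr ⟨1, 0, 0, Fin.elim0, Or.inl rfl, by simp⟩

theorem GoodDet.neg_one (v : ℝ) : GoodDet v (-1) :=
  Or.inr ⟨-1, 0, 0, Fin.elim0, Or.inr rfl, by simp⟩

theorem GoodDet.zpow (v : ℝ) (l : ℤ) : GoodDet v (v ^ l) :=
  Or.inr ⟨1, l, 0, Fin.elim0, Or.inl rfl, by simp⟩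

theorem GoodDet.neg_one_pow {v : ℝ} (hv : 0 < v) (k : ℕ) : GoodDet v ((-1) ^ k) := by
  rcases neg_one_pow_eq_or ℝ k with h | h <;> rw [h]
  exacts [GoodDet.one v, GoodDet.neg_one v]

theorem qint_mul {v : ℝ} (hv : 0 < v) (k : ℤ) :
    (v - v⁻¹) * qint v k = v ^ k - v ^ (-k) := by
  unfold qint
  split_ifs with h
  · subst h; simp
  · have : v - v⁻¹ ≠ 0 := by
      intro h1
      apply h
      have h2 : v * v = 1 := by
        have : v = v⁻¹ := by linarith
        nth_rewrite 2 [this]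
        exact mul_inv_cancel₀ hv.ne'
      nlinarith
    exact mul_div_cancel₀ _ this

theorem GoodDet.sub {v : ℝ} (hv : 0 < v) (p q : ℤ) (h : (p - q) % 2 = 0) :
    GoodDet v (v ^ p - v ^ q) := by
  obtain ⟨k, hk⟩ : ∃ k, p = q + 2 * k := ⟨(p - q) / 2, by omega⟩
  refine Or.inr ⟨1, q + k, 1, fun _ => k, Or.inl rfl, ?_⟩
  have := qint_mul hv k
  simp only [one_mul, pow_one, Finset.univ_unique, Finset.prod_const, Finset.card_singleton]
  rw [mul_assoc, this, mul_sub, ← zpow_add₀ hv.ne', ← zpow_add₀ hv.ne']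
  congr 2 <;> grind

theorem GoodDet.prod {v : ℝ} (hv : 0 < v) {ι : Type*} (s : Finset ι) (f : ι → ℝ)
    (h : ∀ i, GoodDet v (f i)) : GoodDet v (∏ i ∈ s, f i) := by
  classical
  induction s using Finset.induction_on with
  | empty => simpa using GoodDet.one v
  | insert a s ha ih => rw [Finset.prod_insert ha]; exact (h a).mul hv ih

theorem goodDet_loops {v : ℝ} (hv : 0 < v) (n : ℕ) (d : Fin n → ℝ) (r : Fin n → Fin n)
    (hd : ∀ i, GoodDet v (d i)) :
    GoodDet v (Matrix.det (Matrix.of fun l i => if l = r i then d i else 0)) := by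
  by_cases hr : Function.Surjective r
  · have hb : Function.Bijective r := Finite.surjective_iff_bijective.mp hr
    let e := Equiv.ofBijective r hb
    have : (Matrix.of fun l i => if l = r i then d i else 0 : Matrix (Fin n) (Fin n) ℝ)
        = (Matrix.diagonal (fun l => d (e.symm l))).submatrix id e := by
      ext l i
      have he : e i = r i := rfl
      by_cases h : l = r i
      · subst h
        simp [← he]
      · simp [Matrix.diagonal, he, h]
    rw [this, Matrix.det_permute', Matrix.det_diagonal]
    refine GoodDet.mul hv ?_ (GoodDet.prod hv _ _ fun i => hd _)
    rcases Int.units_eq_one_or (Equiv.Perm.sign e) with h | h <;> rw [h]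
    · simpa using GoodDet.one v
    · simpa using GoodDet.neg_one v
  · left
    simp only [Function.Surjective, not_forall, not_exists] at hr
    obtain ⟨l, hl⟩ := hr
    apply Matrix.det_eq_zero_of_row_eq_zero l
    intro i
    simp [Ne.symm (hl i)]

theorem goodDet_main {v : ℝ} (hv : 0 < v) (n : ℕ) : ∀ (p q : Fin n → ℤ) (r s : Fin n → Fin n)
    (_ : ∀ i, (p i - q i) % 2 = 0),
    GoodDet v (Matrix.det (Matrix.of fun l i =>
      (if l = r i then v ^ p i else 0) - (if l = s i then v ^ q i else 0))) := by
  induction n with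
  | zero => intro p q r s h; simpa using GoodDet.one v
  | succ n ih =>
    intro p q r s h
    by_cases hl : ∀ i, r i = s i
    · have := goodDet_loops hv (n + 1) (fun i => v ^ p i - v ^ q i) r
        (fun i => GoodDet.sub hv _ _ (h i))
      convert this using 3
      ext l i
      simp only [← hl i]
      split_ifs <;> simp
    push Not at hl
    obtain ⟨j, hj⟩ := hl
    set A : Matrix (Fin (n + 1)) (Fin (n + 1)) ℝ := Matrix.of fun l i =>
      (if l = r i then v ^ p i else 0) - (if l = s i then v ^ q i else 0) with hA
    have hAe : ∀ l i, A l i =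
      (if l = r i then v ^ p i else 0) - (if l = s i then v ^ q i else 0) := fun _ _ => rfl
    have hv0 := hv.ne'
    have hpj : v ^ p j ≠ 0 := zpow_ne_zero _ hv0
    have hpiv : A (r j) j = v ^ p j := by simp [hAe, hj]
    let c : Fin (n + 1) → ℝ := fun i => if i = j then 0 else - (A (r j) i / v ^ p j)
    let B : Matrix (Fin (n + 1)) (Fin (n + 1)) ℝ := Matrix.of fun l i => A l i + c i * A l j
    have hdet : A.det = B.det := by
      symm
      rw [← Matrix.det_transpose A, ← Matrix.det_transpose B]
      refine Matrix.det_eq_of_forall_row_eq_smul_add_const c j (by simp [c]) ?_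
      intro i l
      rfl
    have hrow : ∀ i, i ≠ j → B (r j) i = 0 := by
      intro i hi
      simp only [B, c, Matrix.of_apply, hi, if_false, hpiv]
      field_simp
      ring
    have hBj : B (r j) j = v ^ p j := by simp [B, c, hpiv]
    rw [hdet, Matrix.det_succ_row B (r j), Finset.sum_eq_single j]
    rotate_left
    · intro i _ hi; simp [hrow i hi]
    · simp
    rw [hBj]
    refine GoodDet.mul hv (GoodDet.mul hv (GoodDet.neg_one_pow hv _) (GoodDet.zpow v _)) ?_
    have hR : ∀ x : Fin (n + 1), ∃ y, (r j).succAbove y = if x = r j then s j else x := by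
      intro x
      apply Fin.exists_succAbove_eq
      split_ifs with hx
      · exact hj.symm
      · exact hx
    choose f hf using hR
    have key := ih
      (fun i => if r (j.succAbove i) = r j then p (j.succAbove i) - p j + q j
        else p (j.succAbove i))
      (fun i => if s (j.succAbove i) = r j then q (j.succAbove i) - p j + q j
        else q (j.succAbove i))
      (fun i => f (r (j.succAbove i))) (fun i => f (s (j.succAbove i)))
      (by
        intro i
        have h1 := h (j.succAbove i)
        have h2 := h j
        split_ifs <;> omega)
    convert key using 2
    ext l i
    have hi : j.succAbove i ≠ j := Fin.succAbove_ne j i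
    have hll : (r j).succAbove l ≠ r j := Fin.succAbove_ne _ l
    have hfe : ∀ x, (l = f x) = ((r j).succAbove l = if x = r j then s j else x) := by
      intro x
      rw [← hf x, Fin.succAbove_right_inj]
    simp only [Matrix.submatrix_apply, Matrix.of_apply, B, c, hi, if_false, hfe, hAe, hll]
    generalize j.succAbove i = i' at *
    generalize (r j).succAbove l = l' at *
    have e1 : ∀ z : ℤ, v ^ (z - p j + q j) = v ^ z / v ^ p j * v ^ q j := by
      intro z; rw [zpow_add₀ hv0, zpow_sub₀ hv0]
    by_cases h1 : r i' = r j <;> by_cases h2 : s i' = r j <;> by_cases h3 : l' = s j <;>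
      simp [h1, h2, h3, hll, e1, eq_comm (a := r j), hj, Ne.symm hj] <;> ring

theorem det_two_entry_cols_qint (n : ℕ) (hn : 2 ≤ n) (v : ℝ) (hv : 0 < v)
    (a : Fin n → ℤ) (A : Matrix (Fin n) (Fin n) ℝ) (r s : Fin n → Fin n)
    (hrs : ∀ i, r i ≠ s i)
    (hr : ∀ i, A (r i) i = v ^ (a i))
    (hs : ∀ i, A (s i) i = -v ^ (-(a i)))
    (h0 : ∀ i l, l ≠ r i → l ≠ s i → A l i = 0) :
    A.det = 0 ∨
    ∃ (ε : ℝ) (l : ℤ) (m : ℕ) (h : Fin m → ℤ),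
      (ε = 1 ∨ ε = -1) ∧
      A.det = ε * v ^ l * (v - v⁻¹) ^ m * ∏ k : Fin m, qint v (h k) := by
  have key := goodDet_main hv n a (fun i => -(a i)) r s (by intro i; omega)
  have hA : A = Matrix.of fun l i =>
      (if l = r i then v ^ a i else 0) - (if l = s i then v ^ (-(a i)) else 0) := by
    ext l i
    by_cases h1 : l = r i
    · subst h1; simp [hr, hrs]
    · by_cases h2 : l = s i
      · subst h2; simp only [Matrix.of_apply, hs, h1]; simp
      · simp [h0 i l h1 h2, h1, h2]
  rw [← hA] at key
  exact key
end

section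
/- Let n ≥ 2 be an integer and v > 0 a real number. Suppose γ_0, γ_1, …, γ_n ∈ Φ(n,v) and there exist indices 1 ≤ i ≤ j ≤ n and p ≠ q in {0,…,n} such that both γ_p and γ_q lie in Φ_{i,j}(n,v). Then det(γ_0, γ_1, …, γ_n) = 0, or there exist ε ∈ {1,−1}, an integer l, an integer m ≥ 1, and positive integers h_1,…,h_m such that det(γ_0, γ_1, …, γ_n) = ε · v^l · (v − v^{−1})^{m−1} · ∏_{k=1}^m c_{h_k}. -/
/-- The determinant of the square matrix whose `l`-th column is `γ l`. -/
noncomputable def detCols {n : ℕ} (γ : Fin n → Fin n → ℝ) : ℝ :=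
  Matrix.det (Matrix.of fun i l => γ l i)

/-- Signed powers of `v`. -/
def IsUn (v u : ℝ) : Prop := ∃ (ε : ℝ) (l : ℤ), (ε = 1 ∨ ε = -1) ∧ u = ε * v ^ l

lemma IsUn.mul {v a b : ℝ} (hv : 0 < v) (ha : IsUn v a) (hb : IsUn v b) : IsUn v (a * b) := by
  obtain ⟨e, l, he, rfl⟩ := ha
  obtain ⟨e', l', he', rfl⟩ := hb
  refine ⟨e * e', l + l', ?_, ?_⟩
  · rcases he with rfl | rfl <;> rcases he' with rfl | rfl <;> simp
  · rw [zpow_add₀ hv.ne']; ring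

lemma IsUn.one (v : ℝ) : IsUn v 1 := ⟨1, 0, Or.inl rfl, by simp⟩

lemma IsUn.negOnePow (v : ℝ) (k : ℕ) : IsUn v ((-1) ^ k) :=
  ⟨(-1) ^ k, 0, neg_one_pow_eq_or ℝ k, by simp⟩

/-- Zero, or a signed power of `v` times a nonempty product of `v^h - v^(-h)`. -/
def IsGd (v d : ℝ) : Prop :=
  d = 0 ∨ ∃ (u : ℝ) (m : ℕ) (h : Fin m → ℤ), IsUn v u ∧ 1 ≤ m ∧ (∀ k, 0 < h k) ∧
    d = u * ∏ k, (v ^ h k - v ^ (-h k))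

lemma IsGd.unMul {v a d : ℝ} (hv : 0 < v) (ha : IsUn v a) (hd : IsGd v d) : IsGd v (a * d) := by
  rcases hd with rfl | ⟨u, m, h, hu, hm, hh, rfl⟩
  · left; simp
  · right
    exact ⟨a * u, m, h, ha.mul hv hu, hm, hh, by ring⟩

lemma loop_factor {v : ℝ} (hv : 0 < v) (p q : ℤ) (hpq : Even (p - q)) :
    v ^ p - v ^ q = 0 ∨ ∃ (u : ℝ) (h : ℤ), IsUn v u ∧ 0 < h ∧
      v ^ p - v ^ q = u * (v ^ h - v ^ (-h)) := by
  obtain ⟨r, hr⟩ := hpq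
  obtain rfl : p = q + r + r := by omega
  rcases lt_trichotomy r 0 with h | h | h
  · right
    refine ⟨-1 * v ^ (q + r), -r, ⟨-1, q + r, Or.inr rfl, rfl⟩, by omega, ?_⟩
    rw [mul_assoc, mul_sub, ← zpow_add₀ hv.ne', ← zpow_add₀ hv.ne']
    have h1 : q + r + -r = q := by ring
    have h2 : q + r + - -r = q + r + r := by ring
    rw [h1, h2]; ring
  · left; simp [h]
  · right
    refine ⟨1 * v ^ (q + r), r, ⟨1, q + r, Or.inl rfl, rfl⟩, by omega, ?_⟩
    rw [mul_assoc, mul_sub, ← zpow_add₀ hv.ne', ← zpow_add₀ hv.ne']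
    have h1 : q + r + -r = q := by ring
    rw [h1]; ring

lemma det_func {N : ℕ} (v : ℝ) (a : Fin N → Fin N) :
    Matrix.det (Matrix.of fun i l => if i = a l then (1 : ℝ) else 0) = 0 ∨
    IsUn v (Matrix.det (Matrix.of fun i l => if i = a l then (1 : ℝ) else 0)) := by
  by_cases ha : Function.Injective a
  · right
    let σ : Equiv.Perm (Fin N) := Equiv.ofBijective a (Finite.injective_iff_bijective.1 ha)
    have : (Matrix.of fun i l => if i = a l then (1 : ℝ) else 0) = (σ.permMatrix ℝ).transpose := by
      ext i l
      simp only [Matrix.of_apply, Matrix.transpose_apply, Equiv.Perm.permMatrix,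
        PEquiv.toMatrix_apply, Equiv.toPEquiv_apply, Option.mem_def, Option.some.injEq]
      simp [σ, eq_comm]
    rw [this, Matrix.det_transpose, Matrix.det_permutation]
    refine ⟨_, 0, ?_, by rw [zpow_zero, mul_one]⟩
    rcases Int.units_eq_one_or (Equiv.Perm.sign σ) with h | h <;> simp [h]
  · left
    simp only [Function.Injective, not_forall] at ha
    obtain ⟨x, y, hxy, hne⟩ := ha
    exact Matrix.det_zero_of_column_eq hne (by intro i; simp [hxy])

lemma det_loops {N : ℕ} {v : ℝ} (hv : 0 < v) (a : Fin (N + 1) → Fin (N + 1))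
    (p q : Fin (N + 1) → ℤ) (hpq : ∀ l, Even (p l - q l)) :
    IsGd v (Matrix.det (Matrix.of fun i l =>
      (if i = a l then v ^ p l else 0) - (if i = a l then v ^ q l else 0))) := by
  have e : (Matrix.of fun i l =>
      (if i = a l then v ^ p l else 0) - (if i = a l then v ^ q l else 0)) =
      Matrix.of fun i l => (v ^ p l - v ^ q l) *
        (Matrix.of fun i l => if i = a l then (1 : ℝ) else 0) i l := by
    ext i l
    simp only [Matrix.of_apply]
    split_ifs <;> simp
  rw [e, Matrix.det_mul_row]
  by_cases hz : ∃ l, v ^ p l - v ^ q l = 0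
  · obtain ⟨l, hl⟩ := hz
    left
    rw [Finset.prod_eq_zero (Finset.mem_univ l) hl, zero_mul]
  · push Not at hz
    rcases det_func v a with h | h
    · left; rw [h, mul_zero]
    · rw [mul_comm]
      refine IsGd.unMul hv h ?_
      have := fun l => (loop_factor hv (p l) (q l) (hpq l)).resolve_left (hz l)
      choose u hh hu hpos heq using this
      right
      refine ⟨∏ l, u l, N + 1, hh, ?_, by omega, hpos, ?_⟩
      · exact Finset.prod_induction _ _ (fun _ _ => IsUn.mul hv) (IsUn.one v) (fun l _ => hu l)
      · rw [← Finset.prod_mul_distrib]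
        exact Finset.prod_congr rfl fun l _ => heq l

lemma det_frame {v : ℝ} (hv : 0 < v) (N : ℕ) : ∀ (a b : Fin (N + 1) → Fin (N + 1))
    (p q : Fin (N + 1) → ℤ) (_ : ∀ l, Even (p l - q l)),
    IsGd v (Matrix.det (Matrix.of fun i l =>
      (if i = a l then v ^ p l else 0) - (if i = b l then v ^ q l else 0))) := by
  induction N with
  | zero =>
    intro a b p q h
    obtain rfl : a = b := funext fun l => Subsingleton.elim (α := Fin 1) _ _
    exact det_loops hv a p q h
  | succ N ih =>
    intro a b p q h
    by_cases hab : ∀ l, a l = b l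
    · obtain rfl : a = b := funext hab
      exact det_loops hv a p q h
    push Not at hab
    obtain ⟨c, hc⟩ := hab
    obtain ⟨y, hy⟩ := Fin.exists_succAbove_eq hc.symm
    set x := a c with hx
    set M : Matrix (Fin (N + 2)) (Fin (N + 2)) ℝ := Matrix.of fun i l =>
      (if i = a l then v ^ p l else 0) - (if i = b l then v ^ q l else 0) with hM
    let s : ℤ := q c - p c
    have hs : Even s := by
      have := h c
      simp only [s]
      rw [← neg_sub]; exact this.neg
    rw [← Matrix.det_updateRow_add_smul_self M (i := b c) (j := x) hc.symm (v ^ s)]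
    rw [Matrix.det_succ_column _ c, Finset.sum_eq_single x]
    rotate_left
    · intro i _ hi
      have : M.updateRow (b c) (M (b c) + v ^ s • M x) i c = 0 := by
        by_cases hib : i = b c
        · subst hib
          simp [hM, ← hx, hc, hc.symm, s, ← zpow_add₀ hv.ne']
        · simp [hM, ← hx, hi, hib]
      rw [this]; simp
    · simp
    have h1 : M.updateRow (b c) (M (b c) + v ^ s • M x) x c = v ^ p c := by
      rw [Matrix.updateRow_ne hc]
      simp [hM, ← hx, hc]
    rw [h1]
    refine IsGd.unMul hv ((IsUn.negOnePow v _).mul hv ⟨1, p c, Or.inl rfl, by simp⟩) ?_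
    have hφ : ∀ z : Fin (N + 2), ∃ (t : Fin (N + 1)) (w : ℤ), Even w ∧ ∀ (r : ℤ) (i : Fin (N + 1)),
        (if x.succAbove i = z then v ^ r else 0) +
          (if i = y then v ^ s * (if x = z then v ^ r else 0) else 0) =
        if i = t then v ^ (r + w) else 0 := by
      intro z
      by_cases hz : z = x
      · refine ⟨y, s, hs, fun r i => ?_⟩
        subst hz
        simp [Fin.succAbove_ne, zpow_add₀ hv.ne', mul_comm]
      · obtain ⟨t, rfl⟩ := Fin.exists_succAbove_eq hz
        refine ⟨t, 0, by simp, fun r i => ?_⟩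
        simp [(Fin.succAbove_ne x t).symm]
    choose t w hw hφ using hφ
    convert ih (fun l => t (a (c.succAbove l))) (fun l => t (b (c.succAbove l)))
      (fun l => p (c.succAbove l) + w (a (c.succAbove l)))
      (fun l => q (c.succAbove l) + w (b (c.succAbove l))) ?_ using 2
    · ext i l
      simp only [Matrix.of_apply, ← hφ, Matrix.submatrix_apply]
      by_cases hi : i = y
      · subst hi
        rw [hy, Matrix.updateRow_self]
        simp only [hM, Matrix.of_apply, Pi.add_apply, Pi.smul_apply, smul_eq_mul, if_true]
        ring
      · rw [Matrix.updateRow_ne (by rw [← hy]; simpa using hi)]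
        simp [hM, hi]
    · intro l
      have := ((h (c.succAbove l)).add (hw (a (c.succAbove l)))).sub (hw (b (c.succAbove l)))
      rw [Int.even_iff] at this ⊢
      omega

/-- The vectors `f_t = α_0 + v(α_1+⋯+α_t) + v⁻¹(α_{t+1}+⋯+α_n)` as columns. -/
noncomputable def fMat (n : ℕ) (v : ℝ) : Matrix (Fin (n + 1)) (Fin (n + 1)) ℝ :=
  Matrix.of fun i t => if (i : ℕ) = 0 then 1 else if (i : ℕ) ≤ t then v else v⁻¹

lemma det_fMat (n : ℕ) (v : ℝ) : (fMat n v).det = (v - v⁻¹) ^ n := by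
  let B : Matrix (Fin (n + 1)) (Fin (n + 1)) ℝ := Matrix.of fun i t =>
    if (t : ℕ) = 0 then (if (i : ℕ) = 0 then 1 else v⁻¹) else if i = t then v - v⁻¹ else 0
  rw [Matrix.det_eq_of_forall_col_eq_smul_add_pred (B := B) (fun _ => 1)]
  · rw [Matrix.det_of_isLowerTriangular]
    · rw [Fin.prod_univ_succ]
      simp [B]
    · intro i j hij
      have hij' : i < j := hij
      have h0 : (j : ℕ) ≠ 0 := by have := Fin.lt_def.1 hij'; omega
      simp only [B, Matrix.of_apply, if_neg h0, if_neg hij'.ne]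
  · intro i
    simp only [fMat, B, Matrix.of_apply, Fin.val_zero]
    have hi := i.2
    rcases Nat.eq_zero_or_pos i with h | h
    · simp [h]
    · simp [h.ne']
  · intro i j
    simp only [fMat, B, Matrix.of_apply, Fin.val_succ, Fin.val_castSucc, Fin.ext_iff,
      if_neg (Nat.succ_ne_zero _)]
    split_ifs <;> first | contradiction | omega | ring

lemma v_one_case (n : ℕ) (γ : Fin (n + 1) → Fin (n + 1) → ℝ) (hγ : ∀ l, γ l ∈ Phi n 1) :
    ∃ z : ℤ, detCols γ = z := by
  have : ∀ l i, ∃ z : ℤ, γ l i = z := by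
    intro l i
    have := hγ l
    simp only [Phi, Set.mem_iUnion] at this
    obtain ⟨a, b, -, -, -, η, m, k, hη, h⟩ := this
    have hη' : ∃ e : ℤ, η = e := by
      rcases hη with rfl | rfl
      · exact ⟨1, by simp⟩
      · exact ⟨-1, by simp⟩
    obtain ⟨e, rfl⟩ := hη'
    have h1 : ∃ z : ℤ, alphaIJ n a b i = z := by
      unfold alphaIJ
      split_ifs
      · exact ⟨1, by simp⟩
      · exact ⟨0, by simp⟩
    have h2 : ∃ z : ℤ, alphaIJ' n 1 a b i = z := by
      unfold alphaIJ'
      split_ifs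
      · exact ⟨1, by simp⟩
      · exact ⟨1, by simp⟩
      · exact ⟨1, by simp⟩
      · exact ⟨0, by simp⟩
    obtain ⟨z1, h1⟩ := h1
    obtain ⟨z2, h2⟩ := h2
    refine ⟨e * ((k + 1) * z1 + k * z2), ?_⟩
    rw [h]
    simp [h1, h2, qint]
  choose z hz using this
  refine ⟨(Matrix.of fun i l => z l i).det, ?_⟩
  rw [detCols, Int.cast_det]
  congr 1
  ext i l
  simp [hz]

lemma root_form {n : ℕ} {v : ℝ} (hv : 0 < v) (h1 : v ≠ 1)
    {g : Fin (n + 1) → ℝ} (hg : g ∈ Phi n v) :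
    ∃ (a b : Fin (n + 1)) (p q : ℤ), Even (p - q) ∧
      ∀ i, g i = (v - v⁻¹)⁻¹ * (v ^ p * fMat n v i a - v ^ q * fMat n v i b) := by
  simp only [Phi, Set.mem_iUnion] at hg
  obtain ⟨a, b, ha, hab, hb, η, m, k, hη, rfl⟩ := hg
  have key : ∀ i : Fin (n + 1),
      ((1 * v ^ m) • (qint v (k + 1) • alphaIJ n a b + qint v k • alphaIJ' n v a b)) i =
      (v - v⁻¹)⁻¹ * (v ^ (m + k) * fMat n v i ⟨b, by omega⟩
        - v ^ (m - k) * fMat n v i ⟨a - 1, by omega⟩) := by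
    intro i
    have hv0 := hv.ne'
    have e1 : v ^ (k + 1) = v ^ k * v := by rw [zpow_add_one₀ hv0]
    have e2 : v ^ (-(k + 1)) = v ^ (-k) * v⁻¹ := by
      rw [neg_add, zpow_add₀ hv0, zpow_neg_one]
    have e3 : v ^ (m + k) = v ^ m * v ^ k := zpow_add₀ hv0 _ _
    have e4 : v ^ (m - k) = v ^ m * v ^ (-k) := by rw [sub_eq_add_neg, zpow_add₀ hv0]
    simp only [Pi.smul_apply, Pi.add_apply, smul_eq_mul, qint, if_neg h1, e1, e2, e3, e4,
      alphaIJ, alphaIJ', fMat, Matrix.of_apply, div_eq_mul_inv]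
    generalize v ^ k = A
    generalize v ^ (-k) = B
    generalize (v - v⁻¹)⁻¹ = C
    split_ifs <;> first | omega | ring
  rcases hη with rfl | rfl
  · exact ⟨_, _, _, _, ⟨k, by ring⟩, key⟩
  · refine ⟨⟨a - 1, by omega⟩, ⟨b, by omega⟩, m - k, m + k, ⟨-k, by ring⟩, fun i => ?_⟩
    have := key i
    simp only [Pi.smul_apply, smul_eq_mul] at this ⊢
    linear_combination -this



/-- if `γ_0, …, γ_n ∈ Φ(n,v)` and two of them, `γ_p` and `γ_q` with `p ≠ q`,
lie in a common `Φ_{i,j}(n,v)` (`1 ≤ i ≤ j ≤ n`), then `det(γ_0, …, γ_n) = 0` or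
`det(γ_0, …, γ_n) = ε v^l (v - v⁻¹)^{m-1} ∏_{k=1}^m c_{h_k}` with `ε = ±1`, `l ∈ ℤ`,
`m ≥ 1` and positive integers `h_1, …, h_m`. -/
theorem det_pair_in_dihedral (n : ℕ) (hn : 2 ≤ n) (v : ℝ) (hv : 0 < v)
    (γ : Fin (n + 1) → Fin (n + 1) → ℝ) (hγ : ∀ l, γ l ∈ Phi n v)
    (i j : ℕ) (hi : 1 ≤ i) (hij : i ≤ j) (hj : j ≤ n)
    (p q : Fin (n + 1)) (hpq : p ≠ q)
    (hp : γ p ∈ PhiIJ n v i j) (hq : γ q ∈ PhiIJ n v i j) :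
    detCols γ = 0 ∨
    ∃ (ε : ℝ) (l : ℤ) (m : ℕ) (h : Fin m → ℤ),
      (ε = 1 ∨ ε = -1) ∧ 1 ≤ m ∧ (∀ k, 0 < h k) ∧
      detCols γ = ε * v ^ l * (v - v⁻¹) ^ (m - 1) * ∏ k : Fin m, qint v (h k) := by
  by_cases h1 : v = 1
  · subst h1
    obtain ⟨z, hz⟩ := v_one_case n γ hγ
    rcases lt_trichotomy z 0 with h | h | h
    · right
      refine ⟨-1, 0, 1, fun _ => -z, Or.inr rfl, le_refl _, fun _ => neg_pos.2 h, ?_⟩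
      simp [hz, qint]
    · left; simp [hz, h]
    · right
      refine ⟨1, 0, 1, fun _ => z, Or.inl rfl, le_refl _, fun _ => h, ?_⟩
      simp [hz, qint]
  have hd : v - v⁻¹ ≠ 0 := by
    intro h
    have h2 : v * v = 1 := by
      have := mul_inv_cancel₀ hv.ne'
      linear_combination v * h + this
    apply h1
    nlinarith
  choose a b P Q hPQ hform using fun l => root_form hv h1 (hγ l)
  have hG := det_frame hv n a b P Q hPQ
  set E : Matrix (Fin (n + 1)) (Fin (n + 1)) ℝ := Matrix.of fun i l =>
    (if i = a l then v ^ P l else 0) - (if i = b l then v ^ Q l else 0) with hE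
  have hmat : (Matrix.of fun i l => γ l i) = (v - v⁻¹)⁻¹ • (fMat n v * E) := by
    ext i l
    rw [Matrix.of_apply, hform l i, Matrix.smul_apply, Matrix.mul_apply, smul_eq_mul]
    simp [hE, mul_sub, Finset.sum_sub_distrib, mul_comm]
  have hdet : detCols γ = (v - v⁻¹)⁻¹ * E.det := by
    rw [detCols, hmat, Matrix.det_smul, Matrix.det_mul, det_fMat, Fintype.card_fin, pow_succ,
      inv_pow]
    generalize v - v⁻¹ = D at hd
    field_simp
  rw [hdet]
  rcases hG with h | ⟨u, m, h, ⟨ε, l, hε, rfl⟩, hm, hh, hEd⟩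
  · left; rw [h, mul_zero]
  · right
    refine ⟨ε, l, m, h, hε, hm, hh, ?_⟩
    rw [hEd]
    have : ∏ k, (v ^ h k - v ^ (-h k)) = (v - v⁻¹) ^ m * ∏ k, qint v (h k) := by
      rw [← Fin.prod_const m, ← Finset.prod_mul_distrib]
      refine Finset.prod_congr rfl fun k _ => ?_
      rw [qint, if_neg h1, mul_div_cancel₀ _ hd]
    rw [this]
    obtain ⟨m, rfl⟩ : ∃ m', m = m' + 1 := ⟨m - 1, by omega⟩
    rw [Nat.add_sub_cancel, pow_succ]
    generalize v - v⁻¹ = D at hd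
    field_simp
end

section
/- Let n ≥ 3 be an integer, v > 0 a real number, and 1 ≤ i ≤ n. Let γ = (x_0, x_1, …, x_n) ∈ Φ(n,v) with γ ∉ Φ_{i,i}(n,v). Then the vector (x_0, …, x_{i−1}, x_{i+1}, …, x_n) ∈ ℝ^n, obtained from γ by deleting the coordinate with index i, belongs to Φ(n−1, v). -/
theorem delete_aux (m : ℕ) (v : ℝ) (i : Fin (m + 2)) (γ : Fin (m + 2) → ℝ) (a b a' b' : ℕ)
    (hγ : γ ∈ PhiIJ (m + 1) v a b)
    (h1 : ∀ l : Fin (m + 1), alphaIJ (m + 1) a b (i.succAbove l) = alphaIJ m a' b' l)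
    (h2 : ∀ l : Fin (m + 1), alphaIJ' (m + 1) v a b (i.succAbove l) = alphaIJ' m v a' b' l)
    (h3 : 1 ≤ a') (h4 : a' ≤ b') (h5 : b' ≤ m) :
    (γ ∘ i.succAbove) ∈ Phi m v := by
  obtain ⟨η, e, k, hη, rfl⟩ := hγ
  simp only [Phi, Set.mem_iUnion]
  refine ⟨a', b', h3, h4, h5, η, e, k, hη, ?_⟩
  funext l
  simp [h1, h2]
  ring

theorem succAbove_val_cases (m : ℕ) (i : Fin (m + 2)) (l : Fin (m + 1)) :
    ((l : ℕ) < i ∧ ((i.succAbove l : Fin (m + 2)) : ℕ) = l) ∨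
    ((i : ℕ) ≤ l ∧ ((i.succAbove l : Fin (m + 2)) : ℕ) = l + 1) := by
  unfold Fin.succAbove
  split_ifs with h
  · left; exact ⟨h, rfl⟩
  · right; exact ⟨by simpa [Fin.lt_def] using h, rfl⟩

/-- (with `n = m + 1 ≥ 3`) if `γ ∈ Φ(n,v)` and `γ ∉ Φ_{i,i}(n,v)` for some
`1 ≤ i ≤ n`, then the vector obtained from `γ` by deleting the coordinate of index `i`
belongs to `Φ(n-1, v)`. -/
theorem delete_coord_mem_Phi (m : ℕ) (hm : 2 ≤ m) (v : ℝ) (hv : 0 < v)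
    (i : Fin (m + 2)) (hi1 : 1 ≤ (i : ℕ)) (hi2 : (i : ℕ) ≤ m + 1)
    (γ : Fin (m + 2) → ℝ) (hγ : γ ∈ Phi (m + 1) v)
    (hnot : γ ∉ PhiIJ (m + 1) v (i : ℕ) (i : ℕ)) :
    (γ ∘ i.succAbove) ∈ Phi m v := by
  simp only [Phi, Set.mem_iUnion] at hγ
  obtain ⟨a, b, ha, hab, hb, hγ⟩ := hγ
  rcases lt_or_ge (i : ℕ) a with h | h
  · apply delete_aux m v i γ a b (a - 1) (b - 1) hγ _ _ (by omega) (by omega) (by omega)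
    all_goals
      intro l
      simp only [alphaIJ, alphaIJ']
      rcases succAbove_val_cases m i l with ⟨h1, h2⟩ | ⟨h1, h2⟩ <;> rw [h2] <;> split_ifs <;>
        first | rfl | (exfalso; omega)
  rcases lt_or_ge b (i : ℕ) with h' | h'
  · apply delete_aux m v i γ a b a b hγ _ _ (by omega) (by omega) (by omega)
    all_goals
      intro l
      simp only [alphaIJ, alphaIJ']
      rcases succAbove_val_cases m i l with ⟨h1, h2⟩ | ⟨h1, h2⟩ <;> rw [h2] <;> split_ifs <;>
        first | rfl | (exfalso; omega)
  have hne : a ≠ b := by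
    rintro rfl
    have : a = (i : ℕ) := by omega
    rw [this] at hγ
    exact hnot hγ
  apply delete_aux m v i γ a b a (b - 1) hγ _ _ (by omega) (by omega) (by omega)
  all_goals
    intro l
    simp only [alphaIJ, alphaIJ']
    rcases succAbove_val_cases m i l with ⟨h1, h2⟩ | ⟨h1, h2⟩ <;> rw [h2] <;> split_ifs <;>
      first | rfl | (exfalso; omega)
end

section
/- Let n ≥ 2 be an integer and v > 0 a real number. For any γ_0, γ_1, …, γ_n ∈ Φ(n,v), either det(γ_0, γ_1, …, γ_n) = 0 or there exist ε ∈ {1,−1}, an integer l, an integer m ≥ 1, and positive integers h_1,…,h_m such that det(γ_0, γ_1, …, γ_n) = ε · v^l · (v − v^{−1})^{m−1} · ∏_{k=1}^m c_{h_k}. -/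
namespace DetPhi

/-- indicator of `x = some i` -/
noncomputable def ind {N : ℕ} (x : Option (Fin N)) (i : Fin N) : ℝ := if x = some i then 1 else 0

/-- functions of `v` which on `v > 0` vanish or are a signed power of `v` times `∏ (v^h - v^{-h})`. -/
def Good (f : ℝ → ℝ) : Prop :=
  (∀ v : ℝ, 0 < v → f v = 0) ∨
  ∃ (ε : ℝ) (p : ℤ) (L : List ℤ), (ε = 1 ∨ ε = -1) ∧ (∀ h ∈ L, 0 < h) ∧
    ∀ v : ℝ, 0 < v → f v = ε * v ^ p * (L.map (fun h => v ^ h - v ^ (-h))).prod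

lemma Good.congr {f g : ℝ → ℝ} (hf : Good f) (h : ∀ v : ℝ, 0 < v → g v = f v) : Good g := by
  rcases hf with hf | ⟨ε, p, L, h1, h2, h3⟩
  · exact Or.inl fun v hv => by rw [h v hv, hf v hv]
  · exact Or.inr ⟨ε, p, L, h1, h2, fun v hv => by rw [h v hv, h3 v hv]⟩

lemma Good.mul {f g : ℝ → ℝ} (hf : Good f) (hg : Good g) : Good (fun v => f v * g v) := by
  rcases hf with hf | ⟨ε, p, L, h1, h2, h3⟩
  · exact Or.inl fun v hv => by simp [hf v hv]
  rcases hg with hg | ⟨ε', p', L', h1', h2', h3'⟩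
  · exact Or.inl fun v hv => by simp [hg v hv]
  refine Or.inr ⟨ε * ε', p + p', L ++ L', ?_, ?_, ?_⟩
  · rcases h1 with rfl | rfl <;> rcases h1' with rfl | rfl <;> simp
  · intro h hh
    rcases List.mem_append.1 hh with hh | hh
    exacts [h2 h hh, h2' h hh]
  · intro v hv
    simp only [h3 v hv, h3' v hv, List.map_append, List.prod_append, zpow_add₀ hv.ne']
    ring

lemma good_zero : Good (fun _ => 0) := Or.inl fun _ _ => rfl

lemma good_one : Good (fun _ => 1) := Or.inr ⟨1, 0, [], Or.inl rfl, by simp, by simp⟩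

lemma good_neg_one : Good (fun _ => -1) := Or.inr ⟨-1, 0, [], Or.inr rfl, by simp, by simp⟩

lemma good_sign (i : ℕ) : Good (fun _ => (-1) ^ i) := by
  rcases neg_one_pow_eq_or ℝ i with h | h
  · rw [h]; exact good_one
  · rw [h]; exact good_neg_one

lemma good_zpow (p : ℤ) : Good (fun v => v ^ p) :=
  Or.inr ⟨1, p, [], Or.inl rfl, by simp, by simp⟩

lemma good_binom (k : ℤ) : Good (fun v => 1 - v ^ (2 * k)) := by
  rcases lt_trichotomy k 0 with h | h | h
  · refine Or.inr ⟨1, k, [-k], Or.inl rfl, by simpa using h, fun v hv => ?_⟩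
    have : v ^ k ≠ 0 := zpow_ne_zero _ hv.ne'
    simp [two_mul, zpow_add₀ hv.ne', mul_sub, this]
  · subst h
    exact Or.inl fun v hv => by simp
  · refine Or.inr ⟨-1, k, [k], Or.inr rfl, by simpa using h, fun v hv => ?_⟩
    have : v ^ k ≠ 0 := zpow_ne_zero _ hv.ne'
    simp [two_mul, zpow_add₀ hv.ne', mul_sub, this]
    ring

lemma Good.prod {ι : Type*} (s : Finset ι) (f : ι → ℝ → ℝ) (hf : ∀ i, Good (f i)) :
    Good (fun v => ∏ i ∈ s, f i v) := by
  classical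
  induction s using Finset.induction_on with
  | empty => simpa using good_one
  | insert a s ha ih => simpa [Finset.prod_insert ha] using (hf a).mul ih

/-- gain graph matrix -/
noncomputable def D {N M : ℕ} (a b : Fin M → Option (Fin N)) (k : Fin M → ℤ) (v : ℝ) :
    Matrix (Fin N) (Fin M) ℝ :=
  Matrix.of fun i l => ind (a l) i - v ^ (2 * k l) * ind (b l) i

/-- contraction: if the minor has columns which are images under a monomial map, it is good. -/
lemma contract {N : ℕ}
    (ih : ∀ (a b : Fin N → Option (Fin N)) (k : Fin N → ℤ), Good (fun v => (D a b k v).det))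
    (π : Option (Fin (N + 1)) → Option (Fin N)) (pot : Option (Fin (N + 1)) → ℤ)
    (a b : Fin N → Option (Fin (N + 1))) (k : Fin N → ℤ)
    (B : ℝ → Matrix (Fin N) (Fin N) ℝ)
    (hB : ∀ v : ℝ, 0 < v → ∀ r l, B v r l = v ^ (2 * pot (a l)) * ind (π (a l)) r
      - v ^ (2 * k l) * (v ^ (2 * pot (b l)) * ind (π (b l)) r)) :
    Good (fun v => (B v).det) := by
  have h1 := ih (fun l => π (a l)) (fun l => π (b l)) (fun l => k l + pot (b l) - pot (a l))
  have h2 := Good.prod Finset.univ (fun (l : Fin N) v => v ^ (2 * pot (a l)))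
    (fun l => good_zpow _)
  refine (h2.mul h1).congr fun v hv => ?_
  rw [← Matrix.det_mul_row]
  congr 1
  ext r l
  rw [hB v hv]
  have : v ^ (pot (a l)) ≠ 0 := zpow_ne_zero _ hv.ne'
  simp only [Matrix.of_apply, D, two_mul, zpow_add₀ hv.ne', zpow_sub₀ hv.ne']
  field_simp

/-- expansion along a column with a single nonzero entry -/
lemma expand {N : ℕ} (A : Matrix (Fin (N + 1)) (Fin (N + 1)) ℝ) (i : Fin (N + 1))
    (h : ∀ r, r ≠ i → A r 0 = 0) :
    A.det = (-1) ^ (i : ℕ) * A i 0 * (A.submatrix i.succAbove Fin.succ).det := by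
  rw [Matrix.det_succ_column_zero]
  refine Finset.sum_eq_single i ?_ (by simp)
  intro r _ hr
  simp [h r hr]

lemma good_single {N : ℕ}
    (ih : ∀ (a b : Fin N → Option (Fin N)) (k : Fin N → ℤ), Good (fun v => (D a b k v).det))
    (a b : Fin (N + 1) → Option (Fin (N + 1))) (k : Fin (N + 1) → ℤ) (i : Fin (N + 1))
    (hc : Good (fun v => D a b k v i 0))
    (h : ∀ v r, r ≠ i → D a b k v r 0 = 0) : Good (fun v => (D a b k v).det) := by
  have h2 := contract ih
    (fun x => x.bind fun y => (finSuccEquiv' i y)) (fun _ => 0)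
    (fun l => a l.succ) (fun l => b l.succ) (fun l => k l.succ)
    (fun v => (D a b k v).submatrix i.succAbove Fin.succ) (by
      have key : ∀ (x : Option (Fin (N + 1))) (r : Fin N),
          ind x (i.succAbove r) = ind (x.bind fun y => (finSuccEquiv' i y)) r := by
        intro x r
        cases x with
        | none => simp [ind]
        | some y =>
          rcases Fin.eq_self_or_eq_succAbove i y with rfl | ⟨z, rfl⟩
          · simp [ind, (Fin.succAbove_ne _ _).symm]
          · simp [ind]
      intro v hv r l
      simp [D, key])
  exact (((good_sign i).mul hc).mul h2).congr fun v hv => expand _ i (h v)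

lemma good_det : ∀ (N : ℕ) (a b : Fin N → Option (Fin N)) (k : Fin N → ℤ),
    Good (fun v => (D a b k v).det) := by
  intro N
  induction N with
  | zero => intro a b k; simpa using good_one
  | succ N ih =>
    intro a b k
    rcases ha : a 0 with _ | i
    · rcases hb : b 0 with _ | j
      · refine good_zero.congr fun v hv => Matrix.det_eq_zero_of_column_eq_zero 0 ?_
        intro r
        simp [D, ha, hb, ind]
      · refine good_single ih a b k j ?_ ?_
        · refine (good_neg_one.mul (good_zpow (2 * k 0))).congr fun v hv => ?_
          simp [D, ha, hb, ind]
        · intro v r hr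
          simp [D, ha, hb, ind, hr.symm]
    · rcases hb : b 0 with _ | j
      · refine good_single ih a b k i ?_ ?_
        · refine good_one.congr fun v hv => ?_
          simp [D, ha, hb, ind]
        · intro v r hr
          simp [D, ha, hb, ind, hr.symm]
      · by_cases hij : j = i
        · subst hij
          refine good_single ih a b k j ?_ ?_
          · refine (good_binom (k 0)).congr fun v hv => ?_
            simp [D, ha, hb, ind]
          · intro v r hr
            simp [D, ha, hb, ind, hr.symm]
        · obtain ⟨z, rfl⟩ := Fin.exists_succAbove_eq hij
          set j := i.succAbove z with hj
          let A : ℝ → Matrix (Fin (N + 1)) (Fin (N + 1)) ℝ := fun v =>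
            (D a b k v).updateRow j (D a b k v j + v ^ (2 * k 0) • D a b k v i)
          have hA : ∀ v, (A v).det = (D a b k v).det := fun v =>
            Matrix.det_updateRow_add_smul_self _ hij _
          have hA2 : ∀ v r l, A v r l = D a b k v r l +
              (if r = j then v ^ (2 * k 0) * D a b k v i l else 0) := by
            intro v r l
            simp only [A, Matrix.updateRow_apply]
            split_ifs with h
            · subst h; simp
            · simp
          have h2 := contract ih
            (fun x => x.bind fun y => some ((finSuccEquiv' i y).getD z))
            (fun x => if x = some i then k 0 else 0)
            (fun l => a l.succ) (fun l => b l.succ) (fun l => k l.succ)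
            (fun v => (A v).submatrix i.succAbove Fin.succ) (by
              have key : ∀ (v : ℝ) (x : Option (Fin (N + 1))) (r : Fin N),
                  ind x (i.succAbove r) + (if r = z then v ^ (2 * k 0) * ind x i else 0) =
                  v ^ (2 * (if x = some i then k 0 else 0)) *
                  ind (x.bind fun y => some ((finSuccEquiv' i y).getD z)) r := by
                intro v x r
                cases x with
                | none => simp [ind]
                | some y =>
                  rcases Fin.eq_self_or_eq_succAbove i y with rfl | ⟨w, rfl⟩
                  · simp [ind, (Fin.succAbove_ne _ _).symm, eq_comm]
                  · simp [ind, Fin.succAbove_ne]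
              intro v hv r l
              rw [← key, ← key]
              simp only [Matrix.submatrix_apply, hA2, hj, Fin.succAbove_right_inj, D,
                Matrix.of_apply]
              split_ifs <;> ring)
          refine (((good_sign i).mul good_one).mul h2).congr fun v hv => ?_
          rw [← hA, expand (A v) i]
          · congr 2
            rw [hA2]
            simp [D, ha, hb, ind, hij, Ne.symm hij]
          · intro r hr
            rw [hA2]
            by_cases hrj : r = j
            · subst hrj
              simp [D, ha, hb, ind, hij, Ne.symm hij]
            · simp [D, ha, hb, ind, hrj, Ne.symm hr, Ne.symm hrj]

/-! quantum integers -/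

lemma sub_inv_ne {v : ℝ} (hv : 0 < v) (h1 : v ≠ 1) : v - v⁻¹ ≠ 0 := by
  intro h
  have h2 : v * v = 1 := by
    have : v = v⁻¹ := sub_eq_zero.1 h
    calc v * v = v * v⁻¹ := by rw [← this]
      _ = 1 := mul_inv_cancel₀ hv.ne'
  exact h1 (by nlinarith)

lemma qint_mul {v : ℝ} (hv : 0 < v) (k : ℤ) : qint v k * (v - v⁻¹) = v ^ k - v ^ (-k) := by
  unfold qint
  split_ifs with h
  · subst h; simp
  · exact div_mul_cancel₀ _ (sub_inv_ne hv h)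

lemma qint_succ {v : ℝ} (hv : 0 < v) (k : ℤ) : qint v (k + 1) = v * qint v k + v ^ (-k) := by
  by_cases h : v = 1
  · subst h; simp [qint]
  · apply mul_right_cancel₀ (sub_inv_ne hv h)
    rw [add_mul, mul_assoc, qint_mul hv, qint_mul hv]
    have : v ^ k ≠ 0 := zpow_ne_zero _ hv.ne'
    simp only [neg_add, zpow_add₀ hv.ne', zpow_neg, zpow_one]
    field_simp
    ring

lemma qint_succ' {v : ℝ} (hv : 0 < v) (k : ℤ) : qint v (k + 1) = v⁻¹ * qint v k + v ^ k := by
  by_cases h : v = 1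
  · subst h; simp [qint]
  · apply mul_right_cancel₀ (sub_inv_ne hv h)
    rw [add_mul, mul_assoc, qint_mul hv, qint_mul hv]
    have : v ^ k ≠ 0 := zpow_ne_zero _ hv.ne'
    simp only [neg_add, zpow_add₀ hv.ne', zpow_neg, zpow_one]
    field_simp
    ring

lemma qint_cont (k : ℤ) : ContinuousAt (fun v => qint v k) 1 := by
  have hpos : ∀ᶠ v : ℝ in nhds 1, 0 < v := lt_mem_nhds one_pos
  have hz : ∀ p : ℤ, ContinuousAt (fun v : ℝ => v ^ p) 1 := fun p =>
    continuousAt_zpow₀ _ _ (Or.inl one_ne_zero)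
  induction k using Int.induction_on with
  | zero =>
    have : (fun v => qint v 0) = fun _ => 0 := by ext v; simp [qint]
    rw [this]; exact continuousAt_const
  | succ i ih =>
    refine ((continuousAt_id.mul ih).add (hz (-i))).congr ?_
    filter_upwards [hpos] with v hv
    simpa using (qint_succ hv i).symm
  | pred i ih =>
    refine ((hz (-1)).mul (ih.sub (hz (-(-i - 1))))).congr ?_
    filter_upwards [hpos] with v hv
    have h := qint_succ hv (-i - 1)
    rw [sub_add_cancel] at h
    simp only [Pi.mul_apply, Pi.sub_apply, h, zpow_neg_one]
    field_simp
    ring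

/-! the coordinate change -/

/-- coordinate change -/
noncomputable def T (n : ℕ) (v : ℝ) : Matrix (Fin (n + 1)) (Fin (n + 1)) ℝ :=
  Matrix.of fun r c => (if (c : ℕ) = r + 1 then 1 else 0) -
    (if c = r then (if (r : ℕ) = 0 then v else 1) else 0) +
    (if (r : ℕ) = n ∧ (c : ℕ) = 0 then v⁻¹ else 0)

lemma T_mulVec (n : ℕ) (hn : 2 ≤ n) (v : ℝ) (x : Fin (n + 1) → ℝ) (r : Fin (n + 1)) :
    (∑ c, T n v r c * x c) =
      (if h : (r : ℕ) + 1 < n + 1 then x ⟨r + 1, h⟩ else v⁻¹ * x 0)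
       - (if (r : ℕ) = 0 then v else 1) * x r := by
  have e2 : (∑ c, (if c = r then (if (r : ℕ) = 0 then v else 1) else 0) * x c) =
      (if (r : ℕ) = 0 then v else 1) * x r := by simp
  have e13 : (∑ c : Fin (n + 1), (if (c : ℕ) = r + 1 then 1 else 0) * x c) +
      (∑ c : Fin (n + 1), (if (r : ℕ) = n ∧ (c : ℕ) = 0 then v⁻¹ else 0) * x c) =
      (if h : (r : ℕ) + 1 < n + 1 then x ⟨r + 1, h⟩ else v⁻¹ * x 0) := by
    by_cases h : (r : ℕ) + 1 < n + 1
    · have h' : (r : ℕ) ≠ n := by omega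
      have : ∀ c : Fin (n + 1), ((c : ℕ) = r + 1) ↔ c = ⟨r + 1, h⟩ :=
        fun c => by simp [Fin.ext_iff]
      simp only [this, h']
      simp [show (r : ℕ) < n by omega]
    · have h' : (r : ℕ) = n := by omega
      have h1 : ∀ c : Fin (n + 1), ¬ ((c : ℕ) = n + 1) := fun c => by omega
      have h2 : ∀ c : Fin (n + 1), ((c : ℕ) = 0) ↔ c = 0 := fun c => by
        rw [Fin.ext_iff]; rfl
      simp only [h', h1, h2, true_and]
      simp
  simp only [T, Matrix.of_apply, add_mul, sub_mul, Finset.sum_add_distrib, Finset.sum_sub_distrib,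
    e2]
  rw [← e13]
  ring

lemma T_det (n : ℕ) (hn : 2 ≤ n) (v : ℝ) :
    (T n v).det = (-1) ^ n * (v⁻¹ - v) := by
  have h1 := Matrix.det_updateRow_sum (T n v) (Fin.last n) (fun _ => 1)
  simp only [one_smul] at h1
  have hcol : ∀ c : Fin (n + 1), (∑ k, T n v k) c = if c = 0 then v⁻¹ - v else 0 := by
    intro c
    refine (Finset.sum_apply (M := fun _ : Fin (n + 1) => ℝ) c Finset.univ (T n v)).trans ?_
    simp only [T, Matrix.of_apply, Finset.sum_add_distrib, Finset.sum_sub_distrib]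
    have e2 : (∑ r : Fin (n + 1), (if c = r then (if (r : ℕ) = 0 then v else 1) else 0)) =
      (if (c : ℕ) = 0 then v else 1) := by simp
    rw [e2]
    have h3 : ∀ r : Fin (n + 1), ((r : ℕ) = n) ↔ r = Fin.last n := fun r => by simp [Fin.ext_iff]
    refine Fin.cases ?_ (fun d => ?_) c
    · simp [h3]
      ring
    · have : ∀ r : Fin (n + 1), ((d : ℕ) = r) ↔ r = d.castSucc :=
        fun r => by simp [Fin.ext_iff, eq_comm]
      simp [this]
  rw [← h1, Matrix.det_succ_row _ (Fin.last n), Finset.sum_eq_single 0]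
  · rw [Matrix.updateRow_self, hcol]
    have : (((T n v).updateRow (Fin.last n) (∑ k, T n v k)).submatrix
        (Fin.last n).succAbove (Fin.succAbove 0)).det = 1 := by
      have hent : ∀ r c : Fin n, (((T n v).updateRow (Fin.last n) (∑ k, T n v k)).submatrix
        (Fin.last n).succAbove (Fin.succAbove 0)) r c =
          (if (c : ℕ) = r then 1 else 0) - (if (c : ℕ) + 1 = r then 1 else 0) := by
        intro r c
        have hr : (r : ℕ) ≠ n := by omega
        have hne : r.castSucc ≠ Fin.last n := (Fin.castSucc_lt_last r).ne
        rw [Matrix.submatrix_apply, Fin.succAbove_last, Matrix.updateRow_ne hne,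
          Fin.zero_succAbove]
        have h1 : (c.succ = r.castSucc) ↔ (c : ℕ) + 1 = r := by simp [Fin.ext_iff]
        rw [T, Matrix.of_apply]
        simp only [h1, Fin.val_succ, Fin.val_castSucc]
        by_cases h : (c : ℕ) + 1 = r
        · have h0 : ¬ (r : ℕ) = 0 := by omega
          have h2 : ¬ (c : ℕ) = r := by omega
          simp [h, h0, h2]
        · simp [h]
      rw [Matrix.det_of_isLowerTriangular]
      · refine Finset.prod_eq_one fun r _ => ?_
        rw [hent]; simp
      · intro r c hrc
        have hrc' : r < c := hrc
        have : (r : ℕ) < c := hrc'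
        rw [hent, if_neg (by omega), if_neg (by omega), sub_zero]
    rw [this]
    simp
  · intro c _ hc
    rw [Matrix.updateRow_self, hcol]
    simp [hc]
  · simp

/-- the basic root vector -/
noncomputable def root (n : ℕ) (i j : ℕ) (k : ℤ) (v : ℝ) : Fin (n + 1) → ℝ :=
  qint v (k + 1) • alphaIJ n i j + qint v k • alphaIJ' n v i j

lemma T_root (n : ℕ) (hn : 2 ≤ n) {v : ℝ} (hv : 0 < v) (i j : ℕ) (hi : 1 ≤ i) (hij : i ≤ j)
    (hj : j ≤ n) (k : ℤ) (r : Fin (n + 1)) :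
    (∑ c, T n v r c * root n i j k v c) =
      v ^ (-k) * (ind (some (⟨i - 1, by omega⟩ : Fin (n + 1))) r
        - v ^ (2 * k) * ind (some (⟨j, by omega⟩ : Fin (n + 1))) r) := by
  rw [T_mulVec n hn]
  have q1 := qint_succ hv k
  have q2 := qint_succ' hv k
  have e : v ^ (-k) * v ^ (2 * k) = v ^ k := by rw [← zpow_add₀ hv.ne']; congr 1; ring
  rw [mul_sub, ← mul_assoc, e]
  have hvv : v * v⁻¹ = 1 := mul_inv_cancel₀ hv.ne'
  simp only [root, alphaIJ, alphaIJ', ind, Pi.add_apply, Pi.smul_apply, smul_eq_mul,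
    Option.some.injEq, Fin.ext_iff, Fin.val_zero]
  by_cases h1 : i - 1 = (r : ℕ) <;> by_cases h2 : j = (r : ℕ) <;>
    by_cases h3 : (r : ℕ) + 1 < n + 1 <;> by_cases h4 : (r : ℕ) = 0 <;>
    simp only [h1, h2, h3, h4, if_true, if_false, dite_true, dite_false] <;>
    split_ifs <;> first | omega | grind

lemma main_nonone (n : ℕ) (hn : 2 ≤ n) (η : Fin (n + 1) → ℝ) (m k : Fin (n + 1) → ℤ)
    (i j : Fin (n + 1) → ℕ) (hη : ∀ l, η l = 1 ∨ η l = -1) (hi : ∀ l, 1 ≤ i l)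
    (hij : ∀ l, i l ≤ j l) (hj : ∀ l, j l ≤ n) :
    Good (fun v => (v - v⁻¹) *
      detCols (fun l => (η l * v ^ m l) • root n (i l) (j l) (k l) v)) := by
  have g1 := good_det (n + 1)
    (fun l => some (⟨i l - 1, by have := hij l; have := hj l; omega⟩ : Fin (n + 1)))
    (fun l => some (⟨j l, by have := hj l; omega⟩ : Fin (n + 1))) k
  have g2 := Good.prod Finset.univ (fun (l : Fin (n + 1)) v => η l * v ^ m l * v ^ (-k l))
    (fun l => by
      have : Good (fun _ => η l) := by
        rcases hη l with h | h <;> rw [h]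
        exacts [good_one, good_neg_one]
      exact (this.mul (good_zpow _)).mul (good_zpow _))
  refine ((good_sign (n + 1)).mul (g2.mul g1)).congr fun v hv => ?_
  have hs : (v - v⁻¹) = (-1) ^ (n + 1) * (T n v).det := by
    rw [T_det n hn, ← mul_assoc, ← pow_add, show n + 1 + n = 2 * n + 1 by ring, pow_succ, pow_mul]
    simp
  rw [hs, mul_assoc, detCols, ← Matrix.det_mul, ← Matrix.det_mul_row]
  congr 2
  ext r l
  simp only [Matrix.mul_apply, Matrix.of_apply, Pi.smul_apply, smul_eq_mul, D]
  rw [mul_assoc (η l * v ^ m l), ← T_root n hn hv (i l) (j l) (hi l) (hij l) (hj l) (k l) r,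
    Finset.mul_sum]
  exact Finset.sum_congr rfl fun c _ => by ring

lemma eq_at_one {f g : ℝ → ℝ} (hf : ContinuousAt f 1) (hg : ContinuousAt g 1)
    (h : ∀ v : ℝ, 0 < v → v ≠ 1 → f v = g v) : ∀ v : ℝ, 0 < v → f v = g v := by
  intro v hv
  by_cases h1 : v = 1
  · subst h1
    have hpos : ∀ᶠ v : ℝ in nhdsWithin 1 {1}ᶜ, 0 < v :=
      (lt_mem_nhds one_pos).filter_mono nhdsWithin_le_nhds
    have hf' := hf.tendsto.mono_left (nhdsWithin_le_nhds (s := {1}ᶜ))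
    have hg' := hg.tendsto.mono_left (nhdsWithin_le_nhds (s := {1}ᶜ))
    refine tendsto_nhds_unique (hf'.congr' ?_) hg'
    filter_upwards [hpos, self_mem_nhdsWithin] with v hv h1
    exact h v hv h1
  · exact h v hv h1

lemma detCols_cont (n : ℕ) (η : Fin (n + 1) → ℝ) (m k : Fin (n + 1) → ℤ)
    (i j : Fin (n + 1) → ℕ) :
    ContinuousAt (fun v => detCols (fun l => (η l * v ^ m l) • root n (i l) (j l) (k l) v)) 1 := by
  unfold detCols
  have hz : ∀ p : ℤ, ContinuousAt (fun v : ℝ => v ^ p) 1 := fun p =>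
    continuousAt_zpow₀ _ _ (Or.inl one_ne_zero)
  have hent : ∀ r l, ContinuousAt
      (fun v => ((η l * v ^ m l) • root n (i l) (j l) (k l) v) r) 1 := by
    intro r l
    simp only [root, Pi.smul_apply, Pi.add_apply, smul_eq_mul, alphaIJ, alphaIJ']
    refine (continuousAt_const.mul (hz _)).mul
      (((qint_cont _).mul continuousAt_const).add ((qint_cont _).mul ?_))
    split_ifs
    · exact continuousAt_const
    · exact continuousAt_id
    · exact continuousAt_inv₀ one_ne_zero
    · exact continuousAt_const
  simp only [Matrix.det_apply', Matrix.of_apply]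
  refine tendsto_finsetSum _ fun σ _ => ?_
  exact tendsto_const_nhds.mul (tendsto_finsetProd _ fun l _ => hent _ _)

lemma list_prod_qint {v : ℝ} (hv : 0 < v) (L : List ℤ) :
    (L.map (fun h => v ^ h - v ^ (-h))).prod =
      (v - v⁻¹) ^ L.length * (L.map (fun h => qint v h)).prod := by
  induction L with
  | nil => simp
  | cons a L ih =>
    rw [List.map_cons, List.prod_cons, ih, List.map_cons, List.prod_cons, List.length_cons,
      ← qint_mul hv, pow_succ]
    ring

lemma list_cont (L : List ℤ) : ContinuousAt (fun v => (L.map (fun h => qint v h)).prod) 1 := by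
  induction L with
  | nil => simpa using continuousAt_const
  | cons a L ih =>
    simp only [List.map_cons, List.prod_cons]
    exact (qint_cont a).mul ih

end DetPhi

/-- for any `γ_0, …, γ_n ∈ Φ(n,v)` (`n ≥ 2`), either `det(γ_0, …, γ_n) = 0`
or `det(γ_0, …, γ_n) = ε v^l (v - v⁻¹)^{m-1} ∏_{k=1}^m c_{h_k}` with `ε = ±1`, `l ∈ ℤ`,
`m ≥ 1` and positive integers `h_1, …, h_m`. -/
theorem det_Phi_general (n : ℕ) (hn : 2 ≤ n) (v : ℝ) (hv : 0 < v)
    (γ : Fin (n + 1) → Fin (n + 1) → ℝ) (hγ : ∀ l, γ l ∈ Phi n v) :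
    detCols γ = 0 ∨
    ∃ (ε : ℝ) (l : ℤ) (m : ℕ) (h : Fin m → ℤ),
      (ε = 1 ∨ ε = -1) ∧ 1 ≤ m ∧ (∀ k, 0 < h k) ∧
      detCols γ = ε * v ^ l * (v - v⁻¹) ^ (m - 1) * ∏ k : Fin m, qint v (h k) := by
  classical
  have hex : ∀ l, ∃ (i j : ℕ) (η : ℝ) (m k : ℤ), 1 ≤ i ∧ i ≤ j ∧ j ≤ n ∧ (η = 1 ∨ η = -1) ∧
      γ l = (η * v ^ m) • DetPhi.root n i j k v := by
    intro l
    have h := hγ l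
    simp only [Phi, PhiIJ, Set.mem_iUnion, Set.mem_ofPred_eq] at h
    obtain ⟨i, j, hi, hij, hj, η, m, k, hη, h⟩ := h
    exact ⟨i, j, η, m, k, hi, hij, hj, hη, h⟩
  choose i j η m k hi hij hj hη hγ' using hex
  obtain rfl : γ = fun l => (η l * v ^ m l) • DetPhi.root n (i l) (j l) (k l) v := funext hγ'
  have hcont := DetPhi.detCols_cont n η m k i j
  rcases DetPhi.main_nonone n hn η m k i j hη hi hij hj with hG | ⟨ε, p, L, hε, hL, hG⟩
  · left
    refine DetPhi.eq_at_one hcont (continuousAt_const (y := (0 : ℝ))) ?_ v hv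
    intro w hw hw1
    exact (mul_eq_zero.1 (hG w hw)).resolve_left (DetPhi.sub_inv_ne hw hw1)
  · right
    have hpos : 1 ≤ L.length := by
      rcases L with _ | ⟨a, L⟩
      · have := hG 1 one_pos
        rcases hε with rfl | rfl <;> simp at this
      · simp
    have hz : ContinuousAt (fun w : ℝ => w ^ p) 1 :=
      continuousAt_zpow₀ _ _ (Or.inl one_ne_zero)
    have hfin : ∀ w : ℝ, 0 < w →
        detCols (fun l => (η l * w ^ m l) • DetPhi.root n (i l) (j l) (k l) w) =
        ε * w ^ p * (w - w⁻¹) ^ (L.length - 1) * (L.map (fun h => qint w h)).prod := by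
      refine DetPhi.eq_at_one hcont (((continuousAt_const.mul hz).mul
        ((continuousAt_id.sub (continuousAt_inv₀ one_ne_zero)).pow _)).mul
          (DetPhi.list_cont L)) ?_
      intro w hw hw1
      apply mul_left_cancel₀ (DetPhi.sub_inv_ne hw hw1)
      refine (hG w hw).trans ?_
      rw [DetPhi.list_prod_qint hw]
      obtain ⟨q, hq⟩ := Nat.exists_eq_add_of_le' hpos
      rw [hq, Nat.add_sub_cancel, pow_succ]
      ring
    refine ⟨ε, p, L.length, fun q => L.get q, hε, hpos, fun q => hL _ (List.get_mem _ _), ?_⟩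
    rw [hfin v hv]
    congr 1
    exact (Fin.prod_univ_fun_getElem L (fun h => qint v h)).symm
end

section
/- Let n ≥ 2 be an integer and let v, v' > 0 be real numbers with sign(v − 1) = sign(v' − 1) (i.e. v and v' are both > 1, both = 1, or both < 1). Then for all words w_0, w_1, …, w_n with letters in {0,…,n} and all indices i_0, i_1, …, i_n ∈ {0,…,n}, sign( det( ρ_v(w_0)(α_{i_0}), …, ρ_v(w_n)(α_{i_n}) ) ) = sign( det( ρ_{v'}(w_0)(α_{i_0}), …, ρ_{v'}(w_n)(α_{i_n}) ) ), where sign takes values in {−1, 0, 1}. -/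
/-- gain of the step from `i` to `i+1` -/
noncomputable def muV (n : ℕ) (v : ℝ) (i : Fin (n + 1)) : ℝ := if (i : ℕ) = n then v ^ 2 else 1

/-- scaling of the simple roots -/
noncomputable def cV (n : ℕ) (v : ℝ) (i : Fin (n + 1)) : ℝ := if (i : ℕ) = 0 then v else 1

/-- covector attached to `y` -/
noncomputable def ellV (n : ℕ) (v : ℝ) (y : Fin (n + 1) → ℝ) (i : Fin (n + 1)) : ℝ :=
  cV n v i * (y i - muV n v i * y (i + 1))

/-- dual action -/
noncomputable def actV (n : ℕ) (v : ℝ) (j : Fin (n + 1)) (y : Fin (n + 1) → ℝ) :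
    Fin (n + 1) → ℝ :=
  fun i => if i = j then muV n v j * y (j + 1) else if i = j + 1 then (muV n v j)⁻¹ * y j else y i

/-- dual action of words -/
noncomputable def actW (n : ℕ) (v : ℝ) : List (Fin (n + 1)) → (Fin (n + 1) → ℝ) → (Fin (n + 1) → ℝ)
  | [] => id
  | j :: w => fun y => actW n v w (actV n v j y)

/-- power map -/
noncomputable def powV {n : ℕ} (t : ℝ) (y : Fin (n + 1) → ℝ) : Fin (n + 1) → ℝ :=
  fun i => |y i| ^ t

lemma fin_succ_val {n : ℕ} (i : Fin (n + 1)) :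
    ((i + 1 : Fin (n + 1)) : ℕ) = if (i : ℕ) = n then 0 else (i : ℕ) + 1 := by
  rw [Fin.val_add_one]
  simp [Fin.ext_iff]

lemma muV_pos (n : ℕ) (v : ℝ) (hv : 0 < v) (i) : 0 < muV n v i := by
  unfold muV; split_ifs <;> positivity

lemma cV_pos (n : ℕ) (v : ℝ) (hv : 0 < v) (i) : 0 < cV n v i := by
  unfold cV; split_ifs <;> positivity

lemma Cmat_succ_left (n : ℕ) (hn : 2 ≤ n) (v : ℝ) (hv : 0 < v) (j : Fin (n + 1)) :
    Cmat n v (j + 1) j * cV n v j * muV n v j = - cV n v (j + 1) := by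
  have h := fin_succ_val j
  have hj := j.2
  simp only [Cmat, cV, muV, Matrix.of_apply, Fin.ext_iff]
  rw [h]
  split_ifs <;> first | omega | (exfalso; simp_all; done) | (field_simp)

lemma Cmat_succ_right (n : ℕ) (hn : 2 ≤ n) (v : ℝ) (hv : 0 < v) (j : Fin (n + 1)) :
    Cmat n v j (j + 1) * cV n v (j + 1) = - cV n v j * muV n v j := by
  have h := fin_succ_val j
  have hj := j.2
  simp only [Cmat, cV, muV, Matrix.of_apply, Fin.ext_iff]
  rw [h]
  split_ifs <;> first | omega | (exfalso; simp_all; done) | (field_simp)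

lemma Cmat_other (n : ℕ) (v : ℝ) (i j : Fin (n + 1)) (h0 : i ≠ j)
    (h1 : i ≠ j + 1) (h2 : j ≠ i + 1) : Cmat n v i j = 0 := by
  have h := fin_succ_val j
  have h' := fin_succ_val i
  have hj := j.2
  have hi := i.2
  rw [Ne, Fin.ext_iff] at h0 h1 h2
  rw [h] at h1
  rw [h'] at h2
  simp only [Cmat, Matrix.of_apply, Fin.ext_iff]
  split_ifs at * <;> first | omega | rfl

lemma ell_key (n : ℕ) (hn : 2 ≤ n) (v : ℝ) (hv : 0 < v) (y : Fin (n + 1) → ℝ)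
    (i j : Fin (n + 1)) :
    ellV n v y i - Cmat n v i j * ellV n v y j = ellV n v (actV n v j y) i := by
  have hs : ∀ k : Fin (n + 1), k + 1 ≠ k := by
    intro k hk
    have := fin_succ_val k
    rw [hk] at this
    split_ifs at this <;> omega
  have hs2 : ∀ k : Fin (n + 1), k + 1 + 1 ≠ k := by
    intro k hk
    have h1 := fin_succ_val (k + 1)
    have h2 := fin_succ_val k
    rw [hk] at h1
    split_ifs at h1 h2 <;> omega
  have hm := (muV_pos n v hv j).ne'
  by_cases h0 : i = j
  · subst h0
    have hC : Cmat n v i i = 2 := by simp [Cmat]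
    simp only [ellV, actV, hC, hs, if_true, if_false]
    field_simp
    ring
  by_cases h1 : i = j + 1
  · subst h1
    have hC := Cmat_succ_left n hn v hv j
    have hC' : Cmat n v (j + 1) j * cV n v j = - cV n v (j + 1) / muV n v j := by
      field_simp; linarith
    simp only [ellV, actV, hs, hs2, if_true, if_false]
    rw [← mul_assoc, hC']
    field_simp
    ring
  by_cases h2 : j = i + 1
  · subst h2
    have hC := Cmat_succ_right n hn v hv i
    simp only [ellV, actV, (hs _).symm, (hs2 _).symm, if_true, if_false]
    rw [← mul_assoc, hC]
    ring
  · rw [Cmat_other n v i j h0 h1 h2]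
    have h3 : i + 1 ≠ j + 1 := fun h => h0 (add_right_cancel h)
    have h4 : i + 1 ≠ j := fun h => h2 h.symm
    simp only [ellV, actV, h0, h1, h3, h4, if_false]
    ring

lemma ell_sigma (n : ℕ) (hn : 2 ≤ n) (v : ℝ) (hv : 0 < v) (y x : Fin (n + 1) → ℝ)
    (j : Fin (n + 1)) :
    ellV n v y ⬝ᵥ sigmaV n v j x = ellV n v (actV n v j y) ⬝ᵥ x := by
  simp only [sigmaV, dotProduct_sub, dotProduct_smul, dotProduct_single, mul_one, smul_eq_mul]
  simp only [dotProduct, Finset.sum_mul, ← Finset.sum_sub_distrib]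
  refine Finset.sum_congr rfl fun i _ => ?_
  rw [← ell_key n hn v hv]; ring

lemma ell_rho (n : ℕ) (hn : 2 ≤ n) (v : ℝ) (hv : 0 < v) (w : List (Fin (n + 1))) :
    ∀ (y x : Fin (n + 1) → ℝ),
    ellV n v y ⬝ᵥ rhoV n v w x = ellV n v (actW n v w y) ⬝ᵥ x := by
  induction w with
  | nil => intro y x; rfl
  | cons j w ih =>
    intro y x
    simp only [rhoV, actW, Function.comp]
    rw [ell_sigma n hn v hv, ih]

lemma muV_pow (n : ℕ) (v v' t : ℝ) (hv : 0 < v) (ht : v ^ t = v') (i) :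
    muV n v i ^ t = muV n v' i := by
  unfold muV
  split_ifs
  · rw [← ht, ← Real.rpow_natCast, ← Real.rpow_natCast, ← Real.rpow_mul hv.le,
      ← Real.rpow_mul hv.le, mul_comm]
  · simp

lemma pow_act (n : ℕ) (v v' t : ℝ) (hv : 0 < v) (ht : v ^ t = v') (j) (y : Fin (n + 1) → ℝ) :
    powV t (actV n v j y) = actV n v' j (powV t y) := by
  have hm := muV_pos n v hv j
  funext i
  simp only [powV, actV, ← muV_pow n v v' t hv ht]
  split_ifs
  · rw [abs_mul, abs_of_pos hm, Real.mul_rpow hm.le (abs_nonneg _)]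
  · rw [abs_mul, abs_of_pos (inv_pos.2 hm), Real.mul_rpow (inv_pos.2 hm).le (abs_nonneg _),
      Real.inv_rpow hm.le]
  · rfl

lemma pow_actW (n : ℕ) (v v' t : ℝ) (hv : 0 < v) (ht : v ^ t = v') (w) :
    ∀ y : Fin (n + 1) → ℝ, powV t (actW n v w y) = actW n v' w (powV t y) := by
  induction w with
  | nil => intro y; rfl
  | cons j w ih =>
    intro y
    simp only [actW]
    rw [ih, pow_act n v v' t hv ht]

lemma pow_ell (n : ℕ) (v v' t : ℝ) (hv : 0 < v) (ht : v ^ t = v') (i)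
    (y : Fin (n + 1) → ℝ) (h : ellV n v y i = 0) : ellV n v' (powV t y) i = 0 := by
  have hm := muV_pos n v hv i
  have h1 : y i = muV n v i * y (i + 1) := by
    rcases mul_eq_zero.1 h with h | h
    · exact absurd h (cV_pos n v hv i).ne'
    · linarith
  simp only [ellV, powV]
  rw [h1, abs_mul, abs_of_pos hm, Real.mul_rpow hm.le (abs_nonneg _), muV_pow n v v' t hv ht]
  ring

lemma ell_inj (n : ℕ) (v : ℝ) (hv : 0 < v) (hv1 : v ≠ 1) (y : Fin (n + 1) → ℝ)
    (h : ellV n v y = 0) : y = 0 := by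
  have h1 : ∀ i, y i = muV n v i * y (i + 1) := by
    intro i
    rcases mul_eq_zero.1 (congrFun h i) with h | h
    · exact absurd h (cV_pos n v hv i).ne'
    · linarith
  have h2 : ∀ k (hk : k < n + 1), y ⟨k, hk⟩ = y 0 := by
    intro k
    induction k with
    | zero => intro hk; rfl
    | succ k ih =>
      intro hk
      rw [← ih (by omega), h1 ⟨k, by omega⟩]
      have hkn : k ≠ n := by omega
      have : (⟨k, by omega⟩ + 1 : Fin (n + 1)) = ⟨k + 1, hk⟩ := by
        rw [Fin.ext_iff, fin_succ_val]; simp [hkn]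
      rw [this]; simp [muV, hkn]
  have h3 := h1 ⟨n, by omega⟩
  have h4 : (⟨n, by omega⟩ + 1 : Fin (n + 1)) = 0 := by
    rw [Fin.ext_iff, fin_succ_val]; simp
  rw [h4, h2 n] at h3
  simp only [muV, if_true] at h3
  have h5 : (v - 1) * ((v + 1) * y 0) = 0 := by nlinarith
  have h6 : y 0 = 0 := by
    rcases mul_eq_zero.1 h5 with h | h
    · exact absurd (by linarith) hv1
    · rcases mul_eq_zero.1 h with h | h
      · linarith
      · exact h
  funext i
  rw [Pi.zero_apply, ← h6]
  exact h2 i.1 i.2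

/-- linear version -/
noncomputable def ellL (n : ℕ) (v : ℝ) : (Fin (n + 1) → ℝ) →ₗ[ℝ] (Fin (n + 1) → ℝ) where
  toFun := ellV n v
  map_add' x y := by funext i; simp only [ellV, Pi.add_apply]; ring
  map_smul' c y := by funext i; simp only [ellV, Pi.smul_apply, smul_eq_mul, RingHom.id_apply]; ring

lemma ell_surj (n : ℕ) (v : ℝ) (hv : 0 < v) (hv1 : v ≠ 1) (l : Fin (n + 1) → ℝ) :
    ∃ y, ellV n v y = l := by
  have hinj : Function.Injective (ellL n v) := by
    rw [← LinearMap.ker_eq_bot, LinearMap.ker_eq_bot']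
    exact fun y hy => ell_inj n v hv hv1 y hy
  exact (LinearMap.injective_iff_surjective.1 hinj) l

lemma det_zero_iff (n : ℕ) (hn : 2 ≤ n) (v : ℝ) (hv : 0 < v) (hv1 : v ≠ 1)
    (w : Fin (n + 1) → List (Fin (n + 1))) (idx : Fin (n + 1) → Fin (n + 1)) :
    (detCols fun l => rhoV n v (w l) (Pi.single (idx l) 1)) = 0 ↔
      ∃ y : Fin (n + 1) → ℝ, y ≠ 0 ∧ ∀ l, ellV n v (actW n v (w l) y) (idx l) = 0 := by
  have key : ∀ y : Fin (n + 1) → ℝ, ∀ l,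
      (Matrix.vecMul (ellV n v y)
        (Matrix.of fun i l => rhoV n v (w l) (Pi.single (idx l) 1) i)) l
      = ellV n v (actW n v (w l) y) (idx l) := by
    intro y l
    have := ell_rho n hn v hv (w l) y (Pi.single (idx l) 1)
    rw [dotProduct_single, mul_one] at this
    rw [← this]; rfl
  unfold detCols
  rw [← Matrix.exists_vecMul_eq_zero_iff]
  constructor
  · rintro ⟨z, hz, h⟩
    obtain ⟨y, rfl⟩ := ell_surj n v hv hv1 z
    refine ⟨y, ?_, fun l => by rw [← key, h]; rfl⟩
    rintro rfl
    exact hz (by funext i; simp [ellV])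
  · rintro ⟨y, hy, h⟩
    exact ⟨ellV n v y, fun h => hy (ell_inj n v hv hv1 y h), by funext l; rw [key, h]; rfl⟩

lemma det_zero_transfer (n : ℕ) (hn : 2 ≤ n) (v v' : ℝ) (hv : 0 < v) (hv1 : v ≠ 1)
    (hv' : 0 < v') (hv1' : v' ≠ 1)
    (w : Fin (n + 1) → List (Fin (n + 1))) (idx : Fin (n + 1) → Fin (n + 1))
    (h : (detCols fun l => rhoV n v (w l) (Pi.single (idx l) 1)) = 0) :
    (detCols fun l => rhoV n v' (w l) (Pi.single (idx l) 1)) = 0 := by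
  rw [det_zero_iff n hn v hv hv1] at h
  rw [det_zero_iff n hn v' hv' hv1']
  obtain ⟨y, hy, h⟩ := h
  have hl : Real.log v ≠ 0 := Real.log_ne_zero_of_pos_of_ne_one hv hv1
  have ht : v ^ (Real.log v' / Real.log v) = v' := by
    rw [Real.rpow_def_of_pos hv, mul_div_cancel₀ _ hl, Real.exp_log hv']
  refine ⟨powV (Real.log v' / Real.log v) y, ?_, fun l => ?_⟩
  · obtain ⟨i, hi⟩ := Function.ne_iff.1 hy
    exact Function.ne_iff.2 ⟨i, (Real.rpow_pos_of_pos (abs_pos.2 hi) _).ne'⟩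
  · rw [← pow_actW n v v' _ hv ht]
    exact pow_ell n v v' _ hv ht _ _ (h l)

lemma cont_C (n : ℕ) (i j : Fin (n + 1)) :
    ContinuousOn (fun v => Cmat n v i j) (Set.Ioi 0) := by
  have h : ContinuousOn (fun v : ℝ => v⁻¹) (Set.Ioi 0) :=
    continuousOn_inv₀.mono fun x hx => ne_of_gt hx
  simp only [Cmat, Matrix.of_apply]
  split_ifs <;> first | exact continuousOn_const | exact continuousOn_id.neg | exact h.neg

lemma cont_rho (n : ℕ) (w : List (Fin (n + 1))) (x : Fin (n + 1) → ℝ) :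
    ∀ k, ContinuousOn (fun v => rhoV n v w x k) (Set.Ioi 0) := by
  induction w with
  | nil => intro k; exact continuousOn_const
  | cons j w ih =>
    intro k
    simp only [rhoV, Function.comp, sigmaV, Pi.sub_apply, Pi.smul_apply, smul_eq_mul]
    exact (ih k).sub ((continuousOn_finsetSum _ fun i _ => (cont_C n i j).mul (ih i)).mul
      continuousOn_const)

lemma cont_det (n : ℕ)
    (w : Fin (n + 1) → List (Fin (n + 1))) (idx : Fin (n + 1) → Fin (n + 1)) :
    ContinuousOn (fun v => detCols fun l => rhoV n v (w l) (Pi.single (idx l) 1)) (Set.Ioi 0) := by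
  unfold detCols
  simp only [Matrix.det_apply']
  exact continuousOn_finsetSum _ fun s _ => continuousOn_const.mul
    (continuousOn_finsetProd _ fun i _ => cont_rho n _ _ _)

lemma sign_const (f : ℝ → ℝ) (s : Set ℝ) (hs : IsPreconnected s) (hf : ContinuousOn f s)
    (h0 : ∀ a ∈ s, ∀ b ∈ s, f a = 0 → f b = 0) (a b : ℝ) (ha : a ∈ s) (hb : b ∈ s) :
    Real.sign (f a) = Real.sign (f b) := by
  have key : ∀ a ∈ s, ∀ b ∈ s, f a < 0 → ¬ 0 < f b := by
    intro a ha b hb h1 h2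
    obtain ⟨c, hc, hc0⟩ := hs.intermediate_value ha hb hf ⟨h1.le, h2.le⟩
    exact h1.ne (h0 c hc a ha hc0)
  rcases lt_trichotomy (f a) 0 with h | h | h <;> rcases lt_trichotomy (f b) 0 with h' | h' | h'
  · rw [Real.sign_of_neg h, Real.sign_of_neg h']
  · exact absurd (h0 b hb a ha h') h.ne
  · exact absurd h' (key a ha b hb h)
  · exact absurd (h0 a ha b hb h) h'.ne
  · rw [h, h']
  · exact absurd (h0 a ha b hb h) h'.ne'
  · exact absurd h (key b hb a ha h')
  · exact absurd (h0 b hb a ha h') h.ne'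
  · rw [Real.sign_of_pos h', Real.sign_of_pos h]

/-- for `n ≥ 2` and `v, v' > 0` with `sign(v - 1) = sign(v' - 1)`, the
chirotopes of the realized root systems of type `Ã_n` with parameters `v` and `v'` agree:
for all words `w_0, …, w_n` and indices `i_0, …, i_n`,
`sign det(ρ_v(w_0)(α_{i_0}), …, ρ_v(w_n)(α_{i_n}))
  = sign det(ρ_{v'}(w_0)(α_{i_0}), …, ρ_{v'}(w_n)(α_{i_n}))`. -/
theorem chirotope_indep_same_side (n : ℕ) (hn : 2 ≤ n) (v v' : ℝ)
    (hv : 0 < v) (hv' : 0 < v') (hsign : Real.sign (v - 1) = Real.sign (v' - 1))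
    (w : Fin (n + 1) → List (Fin (n + 1))) (idx : Fin (n + 1) → Fin (n + 1)) :
    Real.sign (detCols fun l => rhoV n v (w l) (Pi.single (idx l) 1)) =
    Real.sign (detCols fun l => rhoV n v' (w l) (Pi.single (idx l) 1)) := by
  rcases lt_trichotomy (v - 1) 0 with h | h | h <;>
    rcases lt_trichotomy (v' - 1) 0 with h' | h' | h' <;>
    simp only [Real.sign_of_neg, Real.sign_of_pos, Real.sign_zero, h, h'] at hsign <;>
    try norm_num at hsign
  · exact sign_const _ (Set.Ioo 0 1) isPreconnected_Ioo
      ((cont_det n w idx).mono fun x hx => hx.1)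
      (fun a ha b hb => det_zero_transfer n hn a b ha.1 ha.2.ne hb.1 hb.2.ne w idx)
      v v' ⟨hv, by linarith⟩ ⟨hv', by linarith⟩
  · rw [show v = v' by linarith]
  · exact sign_const _ (Set.Ioi 1) isPreconnected_Ioi
      ((cont_det n w idx).mono fun x hx => Set.mem_Ioi.2 (lt_trans one_pos hx))
      (fun a ha b hb => det_zero_transfer n hn a b (lt_trans one_pos ha) (ne_of_gt ha)
        (lt_trans one_pos hb) (ne_of_gt hb) w idx)
      v v' (show 1 < v by linarith) (show 1 < v' by linarith)
end

section
/- Let n ≥ 3 be an integer and let v, v' > 0 be real numbers with sign(v − 1) ≠ sign(v' − 1). Then there exist words w_0, w_1, …, w_n with letters in {0,…,n} and indices i_0, i_1, …, i_n ∈ {0,…,n} such that sign( det( ρ_v(w_0)(α_{i_0}), …, ρ_v(w_n)(α_{i_n}) ) ) ≠ sign( det( ρ_{v'}(w_0)(α_{i_0}), …, ρ_{v'}(w_n)(α_{i_n}) ) ), where sign takes values in {−1, 0, 1}. -/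
/-- The word `j (j+1) ... (n-1)` maps `α_n` to the sum of `α_i` over `i ≥ j`. -/
theorem exists_arc_word (n : ℕ) (k : ℕ) (hk : k + 1 ≤ n) :
    ∃ w : List (Fin (n + 1)), ∀ v : ℝ,
      rhoV n v w (Pi.single (Fin.last n) 1) = fun i : Fin (n + 1) => if n ≤ (i : ℕ) + k then (1 : ℝ) else 0 := by
  induction k with
  | zero =>
    refine ⟨[], fun v => ?_⟩
    funext i
    have hi := i.2
    simp only [rhoV, id, Pi.single_apply, Fin.ext_iff, Fin.val_last]
    congr 1
    apply propext
    omega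
  | succ k ih =>
    obtain ⟨w, hw⟩ := ih (by omega)
    refine ⟨⟨n - (k + 1), by omega⟩ :: w, fun v => ?_⟩
    have hs : (∑ i : Fin (n + 1), Cmat n v i ⟨n - (k + 1), by omega⟩ *
        (if n ≤ (i : ℕ) + k then (1 : ℝ) else 0)) = -1 := by
      rw [Finset.sum_eq_single (⟨n - k, by omega⟩ : Fin (n + 1))]
      · simp only [Cmat, Matrix.of_apply, Fin.ext_iff]
        rw [if_neg (by omega), if_neg (by omega), if_neg (by omega), if_neg (by omega),
          if_neg (by omega), if_pos (by omega), if_pos (by omega)]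
        norm_num
      · intro b _ hb
        have hb' : (b : ℕ) ≠ n - k := fun h => hb (Fin.ext h)
        by_cases h : n ≤ (b : ℕ) + k
        · simp only [Cmat, Matrix.of_apply, Fin.ext_iff]
          rw [if_neg (by omega), if_neg (by omega), if_neg (by omega), if_neg (by omega),
            if_neg (by omega), if_neg (by omega)]
          simp
        · simp [h]
      · simp
    funext i
    have e : rhoV n v (⟨n - (k + 1), by omega⟩ :: w) (Pi.single (Fin.last n) 1)
        = sigmaV n v ⟨n - (k + 1), by omega⟩ (rhoV n v w (Pi.single (Fin.last n) 1)) := rfl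
    rw [e, hw v]
    simp only [sigmaV]
    rw [hs]
    simp only [Pi.sub_apply, Pi.smul_apply, Pi.single_apply, Fin.ext_iff, smul_eq_mul]
    by_cases h1 : n ≤ (i : ℕ) + k
    · rw [if_pos h1, if_neg (by omega), if_pos (by omega)]; norm_num
    · by_cases h2 : (i : ℕ) = n - (k + 1)
      · rw [if_neg h1, if_pos h2, if_pos (by omega)]; norm_num
      · rw [if_neg h1, if_neg h2, if_neg (by omega)]; norm_num

/-- `σ_j` on a simple root. -/
theorem sigmaV_single (n : ℕ) (v : ℝ) (j k : Fin (n + 1)) :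
    sigmaV n v j (Pi.single k 1) = Pi.single k 1 - Cmat n v k j • Pi.single j 1 := by
  simp only [sigmaV]
  congr 2
  simp [Pi.single_apply]

/-- The coordinates of `σ_1 σ_n α_0` at `1` and at `n`. -/
theorem short_root (n : ℕ) (hn : 3 ≤ n) (v : ℝ) (a : Fin (n + 1)) (ha : (a : ℕ) = 1) :
    rhoV n v [a, Fin.last n] (Pi.single 0 1) a = v ∧
    rhoV n v [a, Fin.last n] (Pi.single 0 1) (Fin.last n) = v⁻¹ := by
  have e : rhoV n v [a, Fin.last n] (Pi.single 0 1)
      = sigmaV n v a (sigmaV n v (Fin.last n) (Pi.single 0 1)) := rfl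
  have c1 : Cmat n v 0 (Fin.last n) = -v⁻¹ := by
    simp only [Cmat, Matrix.of_apply, Fin.ext_iff, Fin.val_last, Fin.coe_ofNat_eq_mod, Nat.zero_mod]
    rw [if_neg (by omega), if_neg (by omega), if_neg (by omega), if_neg (by omega),
      if_pos (by simp)]
  have c2 : Cmat n v 0 a = -v := by
    simp only [Cmat, Matrix.of_apply, Fin.ext_iff, Fin.coe_ofNat_eq_mod, Nat.zero_mod]
    rw [if_neg (by omega), if_pos (by simp [ha])]
  have c3 : Cmat n v (Fin.last n) a = 0 := by
    simp only [Cmat, Matrix.of_apply, Fin.ext_iff, Fin.val_last]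
    rw [if_neg (by omega), if_neg (by omega), if_neg (by omega), if_neg (by omega),
      if_neg (by omega), if_neg (by omega)]
  have h0a : a ≠ 0 := by intro h; rw [h] at ha; simp at ha
  have hna : a ≠ Fin.last n := by intro h; rw [h] at ha; simp at ha; omega
  have h0n : Fin.last n ≠ 0 := by intro h; simp [Fin.ext_iff] at h; omega
  have hs : (∑ i, Cmat n v i a *
      ((Pi.single 0 1 - (-v⁻¹) • Pi.single (Fin.last n) 1 : Fin (n + 1) → ℝ) i)) = -v := by
    simp [Pi.single_apply, mul_add, Finset.sum_add_distrib, c2, c3]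
  rw [e, sigmaV_single, c1]
  unfold sigmaV
  rw [hs]
  simp [h0a, hna, h0n, hna.symm]

/-- Determinant of the identity with two columns replaced. -/
theorem detCols_two {m : ℕ} (a b : Fin m) (hab : a ≠ b) (A B : Fin m → ℝ) :
    detCols (fun l => if l = a then A else if l = b then B else Pi.single l 1)
      = A a * B b - B a * A b := by
  let U : Matrix (Fin m) (Fin 2) ℝ :=
    Matrix.of fun i c => if c = 0 then A i - (Pi.single a 1 : Fin m → ℝ) i
      else B i - (Pi.single b 1 : Fin m → ℝ) i
  let V : Matrix (Fin 2) (Fin m) ℝ :=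
    Matrix.of fun c i => if c = 0 then (Pi.single a 1 : Fin m → ℝ) i
      else (Pi.single b 1 : Fin m → ℝ) i
  have h : (Matrix.of fun i l : Fin m =>
      (if l = a then A else if l = b then B else (Pi.single l 1 : Fin m → ℝ)) i) = 1 + U * V := by
    ext i l
    simp only [Matrix.of_apply, Matrix.add_apply, Matrix.mul_apply, Fin.sum_univ_two, U, V,
      Matrix.one_apply, Pi.single_apply]
    by_cases h1 : l = a
    · subst h1
      simp [hab]
    · by_cases h2 : l = b
      · subst h2
        simp [h1]
      · simp [h1, h2, Pi.single_apply]
  unfold detCols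
  rw [h, Matrix.det_one_add_mul_comm, Matrix.det_fin_two]
  simp [U, V, Matrix.mul_apply, Pi.single_apply, hab, hab.symm]

/-- The sign of `v⁻¹ - v` is opposite to the sign of `v - 1`. -/
theorem sign_inv_sub (v : ℝ) (hv : 0 < v) : Real.sign (v⁻¹ - v) = - Real.sign (v - 1) := by
  rcases lt_trichotomy v 1 with h | h | h
  · have := (one_lt_inv₀ hv).2 h
    rw [Real.sign_of_pos (by linarith), Real.sign_of_neg (by linarith)]; norm_num
  · subst h; simp
  · have := inv_lt_one_of_one_lt₀ h
    rw [Real.sign_of_neg (by linarith), Real.sign_of_pos (by linarith)]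

/-- for `n ≥ 3` and `v, v' > 0` with `sign(v - 1) ≠ sign(v' - 1)`, the
chirotopes of the realized root systems of type `Ã_n` with parameters `v` and `v'` differ:
there exist words `w_0, …, w_n` and indices `i_0, …, i_n` with
`sign det(ρ_v(w_0)(α_{i_0}), …, ρ_v(w_n)(α_{i_n}))
  ≠ sign det(ρ_{v'}(w_0)(α_{i_0}), …, ρ_{v'}(w_n)(α_{i_n}))`. -/
theorem chirotope_differs_opposite_side (n : ℕ) (hn : 3 ≤ n) (v v' : ℝ)
    (hv : 0 < v) (hv' : 0 < v') (hsign : Real.sign (v - 1) ≠ Real.sign (v' - 1)) :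
    ∃ (w : Fin (n + 1) → List (Fin (n + 1))) (idx : Fin (n + 1) → Fin (n + 1)),
      Real.sign (detCols fun l => rhoV n v (w l) (Pi.single (idx l) 1)) ≠
      Real.sign (detCols fun l => rhoV n v' (w l) (Pi.single (idx l) 1)) := by
  obtain ⟨w, hw⟩ := exists_arc_word n (n - 1) (by omega)
  let a : Fin (n + 1) := ⟨1, by omega⟩
  have hna : a ≠ Fin.last n := by
    intro h
    have := congrArg Fin.val h
    simp [a] at this
    omega
  let W : Fin (n + 1) → List (Fin (n + 1)) := fun l =>
    if l = a then w else if l = Fin.last n then [a, Fin.last n] else []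
  let I : Fin (n + 1) → Fin (n + 1) := fun l =>
    if l = a then Fin.last n else if l = Fin.last n then 0 else l
  have key : ∀ u : ℝ, detCols (fun l => rhoV n u (W l) (Pi.single (I l) 1)) = u⁻¹ - u := by
    intro u
    have h : (fun l => rhoV n u (W l) (Pi.single (I l) 1)) = fun l =>
        if l = a then rhoV n u w (Pi.single (Fin.last n) 1)
        else if l = Fin.last n then rhoV n u [a, Fin.last n] (Pi.single 0 1)
        else Pi.single l 1 := by
      funext l
      by_cases h1 : l = a
      · simp only [W, I, if_pos h1]
      · by_cases h2 : l = Fin.last n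
        · simp only [W, I, if_neg h1, if_pos h2]
        · simp only [W, I, if_neg h1, if_neg h2, rhoV, id]
    obtain ⟨s1, s2⟩ := short_root n hn u a rfl
    rw [h, detCols_two a (Fin.last n) hna, s1, s2, hw u]
    have e1 : n ≤ (a : ℕ) + (n - 1) := by simp only [a]; omega
    have e2 : n ≤ ((Fin.last n : Fin (n + 1)) : ℕ) + (n - 1) := by simp
    beta_reduce
    rw [if_pos e1, if_pos e2]
    ring
  refine ⟨W, I, ?_⟩
  rw [key v, key v', sign_inv_sub v hv, sign_inv_sub v' hv']
  intro h
  exact hsign (neg_injective h)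
end
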